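/- arXiv:1504.04190 — 10 statements merged into one kernel-verified Lean document; each statement's English description precedes it below -/
import Mathlib

section
/- Let p ∈ (0,1), ε ∈ [0,1], m ∈ ℕ and let f : {0,1}^m → {0,1} be a Boolean function. Then P(f(ω) ≠ f(ω^ε)) = 2(Var(f(ω)) − Cov(f(ω), f(ω^ε))) and Cov(f(ω), f(ω^ε)) ≤ (1−ε)·Var(f(ω)); consequently P(f(ω) ≠ f(ω^ε)) ≥ 2ε·Var(f(ω)). In particular, if δ ∈ (0,1/2] and P(f(ω)=1) ∈ [δ, 1−δ], then P(f(ω) ≠ f(ω^ε)) ≥ 2ε·δ(1−δ). -/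
open MeasureTheory

/-- The Bernoulli(p) measure on `Bool` (probability `p` of `true`). -/
noncomputable def bern (p : ℝ) : Measure Bool :=
  ENNReal.ofReal p • Measure.dirac true + ENNReal.ofReal (1 - p) • Measure.dirac false

/-- Joint law of (ω_i, fresh bit, resample indicator) for one coordinate: the first two
coordinates are Bernoulli(p) and the third (the indicator of resampling) is Bernoulli(ε),
all independent. -/
noncomputable def noiseμ (m : ℕ) (p ε : ℝ) : Measure (Fin m → Bool × Bool × Bool) :=
  Measure.pi fun _ => (bern p).prod ((bern p).prod (bern ε))

/-- The original configuration ω. -/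
def obs {m : ℕ} (σ : Fin m → Bool × Bool × Bool) : Fin m → Bool := fun i => (σ i).1

/-- The noised configuration ω^ε: each coordinate whose resample indicator is `true` is
replaced by the corresponding fresh Bernoulli(p) bit. -/
def pert {m : ℕ} (σ : Fin m → Bool × Bool × Bool) : Fin m → Bool :=
  fun i => if (σ i).2.2 then (σ i).2.1 else (σ i).1

/-- A Boolean as a real number. -/
noncomputable def bval (b : Bool) : ℝ := if b then 1 else 0

theorem isProbabilityMeasure_bern {p : ℝ} (h0 : 0 ≤ p) (h1 : p ≤ 1) :
    IsProbabilityMeasure (bern p) := by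
  constructor
  simp [bern, ← ENNReal.ofReal_add h0 (sub_nonneg.2 h1)]

theorem integral_bern {p : ℝ} (h0 : 0 ≤ p) (h1 : p ≤ 1) (g : Bool → ℝ) :
    ∫ b, g b ∂bern p = p * g true + (1 - p) * g false := by
  have : IsProbabilityMeasure (bern p) := isProbabilityMeasure_bern h0 h1
  rw [bern, integral_add_measure (Integrable.of_finite.smul_measure (by simp))
    (Integrable.of_finite.smul_measure (by simp)), integral_smul_measure, integral_smul_measure,
    integral_dirac, integral_dirac, ENNReal.toReal_ofReal h0,
    ENNReal.toReal_ofReal (sub_nonneg.2 h1), smul_eq_mul, smul_eq_mul]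

theorem isProbabilityMeasure_noiseμ {p ε : ℝ} (hp0 : 0 ≤ p) (hp1 : p ≤ 1) (hε0 : 0 ≤ ε)
    (hε1 : ε ≤ 1) (m : ℕ) : IsProbabilityMeasure (noiseμ m p ε) := by
  have := isProbabilityMeasure_bern hp0 hp1
  have := isProbabilityMeasure_bern hε0 hε1
  unfold noiseμ
  infer_instance

theorem obs_cons {m : ℕ} (a : Bool × Bool × Bool) (σ : Fin m → Bool × Bool × Bool) :
    obs (Fin.cons a σ : Fin (m + 1) → Bool × Bool × Bool) = Fin.cons a.1 (obs σ) := by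
  funext i
  cases i using Fin.cases <;> simp [obs]

theorem pert_cons {m : ℕ} (a : Bool × Bool × Bool) (σ : Fin m → Bool × Bool × Bool) :
    pert (Fin.cons a σ : Fin (m + 1) → Bool × Bool × Bool) =
      Fin.cons (if a.2.2 then a.2.1 else a.1) (pert σ) := by
  funext i
  cases i using Fin.cases <;> simp [pert]

/-- Conditioning a function of `(ω, ω^ε)` on the first coordinate. -/
theorem integral_noiseμ_succ {p ε : ℝ} (hp0 : 0 ≤ p) (hp1 : p ≤ 1) (hε0 : 0 ≤ ε) (hε1 : ε ≤ 1)
    {m : ℕ} (F : (Fin (m + 1) → Bool) → (Fin (m + 1) → Bool) → ℝ) :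
    let I := fun a b : Bool =>
      ∫ σ, F (Fin.cons a (obs σ)) (Fin.cons b (pert σ)) ∂noiseμ m p ε
    ∫ σ, F (obs σ) (pert σ) ∂noiseμ (m + 1) p ε =
      (1 - ε) * (p * I true true + (1 - p) * I false false) +
        ε * (p * (p * I true true + (1 - p) * I true false) +
          (1 - p) * (p * I false true + (1 - p) * I false false)) := by
  intro I
  have := isProbabilityMeasure_bern hp0 hp1
  have := isProbabilityMeasure_bern hε0 hε1
  have := isProbabilityMeasure_noiseμ hp0 hp1 hε0 hε1 m
  have key := (measurePreserving_piFinSuccAbove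
    (fun _ : Fin (m + 1) => (bern p).prod ((bern p).prod (bern ε))) 0).symm.integral_comp'
      (fun σ => F (obs σ) (pert σ))
  have hprod : ∫ x, F (obs (Fin.cons x.1 x.2 : Fin (m + 1) → Bool × Bool × Bool))
        (pert (Fin.cons x.1 x.2 : Fin (m + 1) → Bool × Bool × Bool))
        ∂(((bern p).prod ((bern p).prod (bern ε))).prod (noiseμ m p ε)) =
      ∫ σ, F (obs σ) (pert σ) ∂noiseμ (m + 1) p ε := by
    rw [noiseμ, noiseμ, ← key]
    congr 1
    funext x
    simp [MeasurableEquiv.piFinSuccAbove, Fin.insertNthEquiv]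
  rw [← hprod, integral_prod _ Integrable.of_finite, integral_prod _ Integrable.of_finite,
    integral_bern hp0 hp1, integral_prod _ Integrable.of_finite,
    integral_prod _ Integrable.of_finite, integral_bern hp0 hp1, integral_bern hp0 hp1]
  simp only [integral_bern hε0 hε1, obs_cons, pert_cons, if_true, Bool.false_eq_true, if_false]
  simp only [I]
  ring

/-- The noised configuration has the same law as the original one. -/
theorem integral_pert {p ε : ℝ} (hp0 : 0 ≤ p) (hp1 : p ≤ 1) (hε0 : 0 ≤ ε) (hε1 : ε ≤ 1)
    {m : ℕ} (g : (Fin m → Bool) → ℝ) :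
    ∫ σ, g (pert σ) ∂noiseμ m p ε = ∫ σ, g (obs σ) ∂noiseμ m p ε := by
  induction m with
  | zero => exact integral_congr_ae (.of_forall fun σ => congrArg g (Subsingleton.elim _ _))
  | succ m ih =>
    rw [integral_noiseμ_succ hp0 hp1 hε0 hε1 (fun _ y => g y),
      integral_noiseμ_succ hp0 hp1 hε0 hε1 (fun x _ => g x)]
    have h (a : Bool) := ih fun x => g (Fin.cons a x)
    simp only [h]
    ring

theorem sq_integral_le_integral_sq {Ω : Type*} [Finite Ω] [MeasurableSpace Ω]
    [MeasurableSingletonClass Ω] (μ : Measure Ω) [IsProbabilityMeasure μ] (X : Ω → ℝ) :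
    (∫ x, X x ∂μ) ^ 2 ≤ ∫ x, X x ^ 2 ∂μ := by
  have h : MemLp X 2 μ := by
    rw [memLp_two_iff_integrable_sq .of_discrete]
    exact .of_finite
  have := ProbabilityTheory.variance_nonneg X μ
  rw [ProbabilityTheory.variance_eq_sub h] at this
  simpa using this

/-- The correlation of `g ω` and `g (ω^ε)` is at most `(1 - ε) E[g²] + ε (E g)²`. -/
theorem integral_obs_mul_pert_le {p ε : ℝ} (hp0 : 0 ≤ p) (hp1 : p ≤ 1) (hε0 : 0 ≤ ε)
    (hε1 : ε ≤ 1) {m : ℕ} (g : (Fin m → Bool) → ℝ) :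
    ∫ σ, g (obs σ) * g (pert σ) ∂noiseμ m p ε ≤
      (1 - ε) * ∫ σ, g (obs σ) ^ 2 ∂noiseμ m p ε + ε * (∫ σ, g (obs σ) ∂noiseμ m p ε) ^ 2 := by
  induction m with
  | zero =>
    have := isProbabilityMeasure_noiseμ hp0 hp1 hε0 hε1 0
    have h (x : Fin 0 → Bool) : g x = g Fin.elim0 := congrArg g (Subsingleton.elim _ _)
    simp only [h (obs _), h (pert _), integral_const, probReal_univ, one_smul]
    exact le_of_eq (by ring)
  | succ m ih =>
    have := isProbabilityMeasure_noiseμ hp0 hp1 hε0 hε1 m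
    set g₁ : (Fin m → Bool) → ℝ := fun x => g (Fin.cons true x) with hg₁
    set g₀ : (Fin m → Bool) → ℝ := fun x => g (Fin.cons false x) with hg₀
    have split (F : (Fin m → Bool × Bool × Bool) → ℝ) (c d : ℝ)
        (G : (Fin m → Bool × Bool × Bool) → ℝ) :
        ∫ σ, (c * F σ + d * G σ) ∂noiseμ m p ε =
          c * ∫ σ, F σ ∂noiseμ m p ε + d * ∫ σ, G σ ∂noiseμ m p ε := by
      rw [integral_add .of_finite .of_finite, integral_const_mul, integral_const_mul]
    have ih₁ := ih g₁
    have ih₀ := ih g₀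
    have ihm := ih fun x => p * g₁ x + (1 - p) * g₀ x
    have hmean := split (fun σ => g₁ (obs σ)) p (1 - p) (fun σ => g₀ (obs σ))
    have hcorr : ∫ σ, (p * g₁ (obs σ) + (1 - p) * g₀ (obs σ)) *
          (p * g₁ (pert σ) + (1 - p) * g₀ (pert σ)) ∂noiseμ m p ε =
        p * (p * ∫ σ, g₁ (obs σ) * g₁ (pert σ) ∂noiseμ m p ε +
            (1 - p) * ∫ σ, g₁ (obs σ) * g₀ (pert σ) ∂noiseμ m p ε) +
          (1 - p) * (p * ∫ σ, g₀ (obs σ) * g₁ (pert σ) ∂noiseμ m p ε +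
            (1 - p) * ∫ σ, g₀ (obs σ) * g₀ (pert σ) ∂noiseμ m p ε) := by
      rw [← split, ← split, ← split]
      congr 1
      funext σ
      ring
    have hsq : ∫ σ, (p * g₁ (obs σ) + (1 - p) * g₀ (obs σ)) ^ 2 ∂noiseμ m p ε =
        1 * (p * ∫ σ, g₁ (obs σ) ^ 2 ∂noiseμ m p ε +
          (1 - p) * ∫ σ, g₀ (obs σ) ^ 2 ∂noiseμ m p ε) +
        (-(p * (1 - p))) * ∫ σ, (g₁ (obs σ) - g₀ (obs σ)) ^ 2 ∂noiseμ m p ε := by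
      rw [← split, ← split]
      congr 1
      funext σ
      ring
    have hdiff := sq_integral_le_integral_sq (noiseμ m p ε) fun σ => g₁ (obs σ) - g₀ (obs σ)
    rw [integral_sub .of_finite .of_finite] at hdiff
    rw [hmean, hcorr, hsq] at ihm
    rw [integral_noiseμ_succ hp0 hp1 hε0 hε1 (fun x y => g x * g y),
      integral_noiseμ_succ hp0 hp1 hε0 hε1 (fun x _ => g x ^ 2),
      integral_noiseμ_succ hp0 hp1 hε0 hε1 (fun x _ => g x)]
    simp only [hg₁, hg₀] at ih₁ ih₀ ihm hdiff
    have hq : 0 ≤ 1 - p := sub_nonneg.2 hp1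
    have hδ : 0 ≤ 1 - ε := sub_nonneg.2 hε1
    have t₁ := mul_le_mul_of_nonneg_left ih₁ (mul_nonneg hδ hp0)
    have t₀ := mul_le_mul_of_nonneg_left ih₀ (mul_nonneg hδ hq)
    have tm := mul_le_mul_of_nonneg_left ihm hε0
    have td := mul_le_mul_of_nonneg_left hdiff
      (mul_nonneg (mul_nonneg hδ hε0) (mul_nonneg hp0 hq))
    linarith

theorem bval_sq (b : Bool) : bval b ^ 2 = bval b := by
  cases b <;> simp [bval]

theorem toReal_measure_eq_true {Ω : Type*} [MeasurableSpace Ω] [DiscreteMeasurableSpace Ω]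
    (μ : Measure Ω) (h : Ω → Bool) :
    (μ {x | h x = true}).toReal = ∫ x, bval (h x) ∂μ := by
  have : (fun x => bval (h x)) = Set.indicator {x | h x = true} 1 := by
    funext x
    simp [bval, Set.indicator_apply]
  rw [this, integral_indicator_one .of_discrete, Measure.real]

theorem toReal_measure_ne {Ω : Type*} [Finite Ω] [MeasurableSpace Ω]
    [DiscreteMeasurableSpace Ω] (μ : Measure Ω) [IsFiniteMeasure μ] (h k : Ω → Bool) :
    (μ {x | h x ≠ k x}).toReal =
      ∫ x, bval (h x) ∂μ + ∫ x, bval (k x) ∂μ - 2 * ∫ x, bval (h x) * bval (k x) ∂μ := by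
  have hset : {x | h x ≠ k x} = {x | (h x ^^ k x) = true} := by
    ext x
    simp
  rw [hset, toReal_measure_eq_true, ← integral_const_mul, ← integral_add .of_finite .of_finite,
    ← integral_sub .of_finite .of_finite]
  congr 1
  funext x
  cases h x <;> cases k x <;> norm_num [bval]

/-- For p ∈ (0,1), ε ∈ [0,1] and f : {0,1}^m → {0,1}:
P(f(ω) ≠ f(ω^ε)) = 2(Var(f(ω)) − Cov(f(ω), f(ω^ε))), Cov(f(ω),f(ω^ε)) ≤ (1−ε)Var(f(ω)),
hence P(f(ω) ≠ f(ω^ε)) ≥ 2ε·Var(f(ω)); and if δ ∈ (0,1/2] with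
P(f(ω)=1) ∈ [δ, 1−δ], then P(f(ω) ≠ f(ω^ε)) ≥ 2ε·δ(1−δ). -/
theorem stmt_0 (p ε : ℝ) (hp0 : 0 < p) (hp1 : p < 1) (hε0 : 0 ≤ ε) (hε1 : ε ≤ 1)
    (m : ℕ) (f : (Fin m → Bool) → Bool) :
    let μ := noiseμ m p ε
    let EX := ∫ σ, bval (f (obs σ)) ∂μ
    let EY := ∫ σ, bval (f (pert σ)) ∂μ
    let Var := (∫ σ, bval (f (obs σ)) ^ 2 ∂μ) - EX ^ 2
    let Cov := (∫ σ, bval (f (obs σ)) * bval (f (pert σ)) ∂μ) - EX * EY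
    let Pneq := (μ {σ | f (obs σ) ≠ f (pert σ)}).toReal
    Pneq = 2 * (Var - Cov) ∧
    Cov ≤ (1 - ε) * Var ∧
    2 * ε * Var ≤ Pneq ∧
    (∀ δ : ℝ, 0 < δ → δ ≤ 1/2 →
      δ ≤ (μ {σ | f (obs σ) = true}).toReal →
      (μ {σ | f (obs σ) = true}).toReal ≤ 1 - δ →
      2 * ε * (δ * (1 - δ)) ≤ Pneq) := by
  intro μ EX EY Var Cov Pneq
  have hp0' := hp0.le
  have hp1' := hp1.le
  have : IsProbabilityMeasure μ := isProbabilityMeasure_noiseμ hp0' hp1' hε0 hε1 m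
  have hEY : EY = EX := integral_pert hp0' hp1' hε0 hε1 fun x => bval (f x)
  have hVar : Var = EX - EX ^ 2 := by simp only [Var, EX, bval_sq]
  have hne : Pneq = 2 * (Var - Cov) := by
    have h : Pneq = EX + EY - 2 * ∫ σ, bval (f (obs σ)) * bval (f (pert σ)) ∂μ :=
      toReal_measure_ne μ _ _
    simp only [h, hVar, Cov, hEY]
    ring
  have hCov : Cov ≤ (1 - ε) * Var := by
    have h : ∫ σ, bval (f (obs σ)) * bval (f (pert σ)) ∂μ ≤
        (1 - ε) * ∫ σ, bval (f (obs σ)) ^ 2 ∂μ + ε * EX ^ 2 :=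
      integral_obs_mul_pert_le hp0' hp1' hε0 hε1 fun x => bval (f x)
    simp only [Cov, Var, hEY]
    linarith
  have hnoise : 2 * ε * Var ≤ Pneq := by linarith
  refine ⟨hne, hCov, hnoise, fun δ _ _ hlo hhi => le_trans ?_ hnoise⟩
  rw [toReal_measure_eq_true μ fun σ => f (obs σ)] at hlo hhi
  change δ ≤ EX at hlo
  change EX ≤ 1 - δ at hhi
  refine mul_le_mul_of_nonneg_left ?_ (by positivity)
  rw [hVar]
  nlinarith [mul_nonneg (sub_nonneg.2 hlo) (sub_nonneg.2 hhi)]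
end

section
/- For n ≥ 1, let m_n = 1 + n + 3^n and define f_n : {0,1}^{m_n} → {0,1} by: f_n(x) = x_1 unless coordinates x_2, …, x_{n+1} are all equal to 1, in which case f_n(x) is the mod-2 sum of x_{n+2}, …, x_{m_n}. Then, at p = 1/2: (a) P(f_n(ω) = 1) = 1/2 for every n; (b) the total influence satisfies Σ_{i=1}^{m_n} I_i^{1/2}(f_n) ≥ (1/2)(3/2)^n, which tends to infinity; and (c) the sequence {f_n} is noise stable with respect to p_n ≡ 1/2. -/
open MeasureTheory

/-- The influence `I_i^p(f) = P(f(ω) ≠ f(ω^i))`. -/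
noncomputable def influence (m : ℕ) (p : ℝ) (f : (Fin m → Bool) → Bool) (i : Fin m) : ℝ :=
  (((Measure.pi fun _ : Fin m => bern p).prod (bern p))
    {σ | f σ.1 ≠ f (Function.update σ.1 i σ.2)}).toReal

/-- The function on `m_n = 1 + n + 3^n` bits which outputs the first bit, unless bits
2,…,n+1 are all 1, in which case it outputs the mod-2 sum of the last `3^n` bits. -/
def g (n : ℕ) (x : Fin (1 + n + 3^n) → Bool) : Bool :=
  if ∀ j : Fin n, x ⟨1 + j.1, by
      have hj := j.isLt
      have h3 : 1 ≤ (3:ℕ)^n := Nat.one_le_pow _ _ (by norm_num)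
      omega⟩ = true
  then decide ((∑ j : Fin (3^n), (if x ⟨1 + n + j.1, by
      have hj := j.isLt
      omega⟩ then 1 else 0)) % 2 = 1)
  else x ⟨0, by
      have h3 : 1 ≤ (3:ℕ)^n := Nat.one_le_pow _ _ (by norm_num)
      omega⟩

namespace NoiseStableExample

section General

variable {Ω : Type*} [MeasurableSpace Ω] {μ : Measure Ω}

/-- An event exchanged with its complement by a measure-preserving map has half the mass of any
invariant event it is intersected with. -/
lemma toReal_inter_of_preimage_eq_compl [IsFiniteMeasure μ] {T : Ω → Ω}
    (hT : MeasurePreserving T μ μ) {A E : Set Ω} (hA : MeasurableSet A) (hE : MeasurableSet E)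
    (hTA : T ⁻¹' A = Aᶜ) (hTE : T ⁻¹' E = E) :
    (μ (E ∩ A)).toReal = (μ E).toReal / 2 := by
  have h1 : μ (E ∩ A) = μ (E \ A) := by
    rw [← hT.measure_preimage (hE.inter hA).nullMeasurableSet, Set.preimage_inter, hTA, hTE,
      Set.sdiff_eq]
  have h2 := measure_inter_add_sdiff (μ := μ) E hA
  rw [← h1] at h2
  rw [← h2, ENNReal.toReal_add (measure_ne_top _ _) (measure_ne_top _ _)]
  ring

lemma measure_toReal_eq_half [IsProbabilityMeasure μ] {T : Ω → Ω}
    (hT : MeasurePreserving T μ μ) {A : Set Ω} (hA : MeasurableSet A) (hTA : T ⁻¹' A = Aᶜ) :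
    (μ A).toReal = 1 / 2 := by
  have h := toReal_inter_of_preimage_eq_compl hT hA MeasurableSet.univ hTA Set.preimage_univ
  simpa using h

lemma pi_forall_mem [IsProbabilityMeasure μ] {ι κ : Type*} [Fintype ι] [Fintype κ]
    {e : κ → ι} (he : Function.Injective e) (A : Set Ω) :
    Measure.pi (fun _ : ι => μ) {x | ∀ j, x (e j) ∈ A} = μ A ^ Fintype.card κ := by
  classical
  have hset : {x : ι → Ω | ∀ j, x (e j) ∈ A}
      = Set.univ.pi fun i => if i ∈ Finset.univ.image e then A else Set.univ := by
    ext x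
    simp only [Set.mem_ofPred_eq, Set.mem_pi, Set.mem_univ, true_imp_iff]
    constructor
    · intro h i
      split_ifs with hi
      · obtain ⟨j, -, rfl⟩ := Finset.mem_image.1 hi
        exact h j
      · trivial
    · intro h j
      simpa using h (e j)
  rw [hset, Measure.pi_pi]
  have hprod : ∀ i : ι, μ (if i ∈ Finset.univ.image e then A else Set.univ)
      = if i ∈ Finset.univ.image e then μ A else 1 := by
    intro i
    split_ifs <;> simp
  simp only [hprod, Finset.prod_ite_mem, Finset.univ_inter, Finset.prod_const,
    Finset.card_image_of_injective _ he, Finset.card_univ]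

end General

lemma isProbabilityMeasure_bern {p : ℝ} (h0 : 0 ≤ p) (h1 : p ≤ 1) :
    IsProbabilityMeasure (bern p) := by
  constructor
  simp only [bern, Measure.add_apply, Measure.smul_apply, measure_univ, smul_eq_mul, mul_one]
  rw [← ENNReal.ofReal_add h0 (by linarith)]
  simp

instance isProbabilityMeasure_bern_half : IsProbabilityMeasure (bern (1 / 2)) :=
  isProbabilityMeasure_bern (by norm_num) (by norm_num)

lemma bern_singleton_true {p : ℝ} : bern p {true} = ENNReal.ofReal p := by
  simp [bern]

lemma measurePreserving_not : MeasurePreserving not (bern (1 / 2)) (bern (1 / 2)) := by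
  refine ⟨Measurable.of_discrete, ?_⟩
  have h : (1 : ℝ) - 1 / 2 = 1 / 2 := by norm_num
  simp only [bern, h]
  rw [Measure.map_add _ _ Measurable.of_discrete, Measure.map_smul, Measure.map_smul,
    Measure.map_dirac' Measurable.of_discrete, Measure.map_dirac' Measurable.of_discrete,
    add_comm]
  rfl

/-- Negating the coordinates in a given set preserves the uniform measure. -/
lemma measurePreserving_flip {m : ℕ} (s : Fin m → Prop) [DecidablePred s] :
    MeasurePreserving (fun (x : Fin m → Bool) i => if s i then !x i else x i)
      (Measure.pi fun _ => bern (1 / 2)) (Measure.pi fun _ => bern (1 / 2)) := by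
  refine measurePreserving_pi (fun _ => bern (1 / 2)) (fun _ => bern (1 / 2))
    (f := fun i b => if s i then !b else b) fun i => ?_
  by_cases h : s i
  · simpa only [h, if_true] using measurePreserving_not
  · simpa only [h, if_false] using! MeasurePreserving.id _

/-- The perturbed value of a single coordinate is `true` with probability `1/2`. -/
lemma pert_coord_true {ε : ℝ} (h0 : 0 ≤ ε) (h1 : ε ≤ 1) :
    (((bern (1 / 2)).prod ((bern (1 / 2)).prod (bern ε)))
      {t : Bool × Bool × Bool | (if t.2.2 then t.2.1 else t.1) = true}).toReal = 1 / 2 := by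
  have := isProbabilityMeasure_bern h0 h1
  refine measure_toReal_eq_half
    (measurePreserving_not.prod (measurePreserving_not.prod (MeasurePreserving.id _)))
    MeasurableSet.of_discrete ?_
  ext ⟨a, b, c⟩
  cases a <;> cases b <;> cases c <;> simp

/-- The first coordinate, which decides the output outside the exceptional event. -/
def firstIdx (n : ℕ) : Fin (1 + n + 3 ^ n) := ⟨0, by positivity⟩

/-- The coordinates that define the exceptional event. -/
def selIdx (n : ℕ) (j : Fin n) : Fin (1 + n + 3 ^ n) := ⟨1 + j.1, by have := Nat.pow_pos (n := n) (show 0 < 3 by norm_num); omega⟩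

/-- The coordinates entering the mod-2 sum. -/
def parIdx (n : ℕ) (j : Fin (3 ^ n)) : Fin (1 + n + 3 ^ n) := ⟨1 + n + j.1, by omega⟩

lemma selIdx_injective (n : ℕ) : Function.Injective (selIdx n) := by
  intro a b h
  simp only [selIdx, Fin.mk.injEq] at h
  exact Fin.ext (by omega)

lemma parIdx_injective (n : ℕ) : Function.Injective (parIdx n) := by
  intro a b h
  simp only [parIdx, Fin.mk.injEq] at h
  exact Fin.ext (by omega)

lemma selIdx_ne_parIdx {n : ℕ} (j : Fin n) (k : Fin (3 ^ n)) : selIdx n j ≠ parIdx n k := by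
  simp only [selIdx, parIdx, ne_eq, Fin.mk.injEq]
  omega

lemma selIdx_ne_firstIdx {n : ℕ} (j : Fin n) : selIdx n j ≠ firstIdx n := by
  simp only [selIdx, firstIdx, ne_eq, Fin.mk.injEq]
  omega

/-- The mod-2 sum of a finite family of bits. -/
def parity {k : ℕ} (y : Fin k → Bool) : Bool :=
  decide ((∑ j, (if y j then 1 else 0)) % 2 = 1)

lemma parity_of_flip {k : ℕ} {x y : Fin k → Bool} (j : Fin k) (hj : y j = !x j)
    (h : ∀ i, i ≠ j → y i = x i) : parity y = !parity x := by
  have hsum : ∑ i ∈ Finset.univ.erase j, (if y i then 1 else 0)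
      = ∑ i ∈ Finset.univ.erase j, (if x i then 1 else 0) :=
    Finset.sum_congr rfl fun i hi => by rw [h i (Finset.ne_of_mem_erase hi)]
  unfold parity
  rw [← Finset.add_sum_erase _ _ (Finset.mem_univ j), hsum,
    ← Finset.add_sum_erase (f := fun i => if x i then 1 else 0) _ (Finset.mem_univ j), hj]
  generalize ∑ i ∈ Finset.univ.erase j, (if x i then 1 else 0) = s
  cases x j
  all_goals
    simp only [Bool.not_true, Bool.not_false, if_true, Bool.false_eq_true, if_false,
      ← decide_not, decide_eq_decide]
    omega

lemma g_eq (n : ℕ) (x : Fin (1 + n + 3 ^ n) → Bool) :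
    g n x = if ∀ j, x (selIdx n j) = true then parity (fun j => x (parIdx n j))
      else x (firstIdx n) := rfl

lemma g_of_flip {n : ℕ} {x y : Fin (1 + n + 3 ^ n) → Bool} (k : Fin (3 ^ n))
    (hsel : ∀ j, x (selIdx n j) = true) (hk : y (parIdx n k) = !x (parIdx n k))
    (h : ∀ i, i ≠ parIdx n k → y i = x i) : g n y = !g n x := by
  have hsel' : ∀ j, y (selIdx n j) = true := fun j => by
    rw [h _ (selIdx_ne_parIdx j k), hsel j]
  rw [g_eq, g_eq, if_pos hsel, if_pos hsel']
  exact parity_of_flip k hk fun i hi => h _ fun hik => hi (parIdx_injective n hik)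

theorem g_balanced (n : ℕ) :
    ((Measure.pi fun _ : Fin (1 + n + 3 ^ n) => bern (1 / 2)) {x | g n x = true}).toReal
      = 1 / 2 := by
  let k : Fin (3 ^ n) := ⟨0, by positivity⟩
  refine measure_toReal_eq_half
    (measurePreserving_flip fun i => i = firstIdx n ∨ i = parIdx n k) MeasurableSet.of_discrete ?_
  ext x
  set y : Fin (1 + n + 3 ^ n) → Bool :=
    fun i => if i = firstIdx n ∨ i = parIdx n k then !x i else x i with hy
  have hsel : ∀ j, y (selIdx n j) = x (selIdx n j) := fun j => by
    simp [hy, selIdx_ne_firstIdx, selIdx_ne_parIdx]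
  have hg : g n y = !g n x := by
    rw [g_eq, g_eq]
    simp only [hsel]
    split_ifs
    · refine parity_of_flip k (by simp [hy]) fun i hi => ?_
      have h1 : parIdx n i ≠ firstIdx n := by
        simp only [parIdx, firstIdx, ne_eq, Fin.mk.injEq]
        omega
      simp [hy, h1, (parIdx_injective n).ne hi]
    · simp [hy]
  change g n y = true ↔ ¬ g n x = true
  simp [hg]

lemma pi_forall_selIdx (n : ℕ) :
    ((Measure.pi fun _ : Fin (1 + n + 3 ^ n) => bern (1 / 2))
      {x | ∀ j, x (selIdx n j) = true}).toReal = (1 / 2) ^ n := by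
  have h := pi_forall_mem (μ := bern (1 / 2)) (selIdx_injective n) {true}
  simp only [Set.mem_singleton_iff] at h
  rw [h, bern_singleton_true, ENNReal.toReal_pow, ENNReal.toReal_ofReal (by norm_num),
    Fintype.card_fin]

theorem influence_parIdx_ge (n : ℕ) (k : Fin (3 ^ n)) :
    (1 / 2) ^ n / 2 ≤ influence (1 + n + 3 ^ n) (1 / 2) (g n) (parIdx n k) := by
  set ν := (Measure.pi fun _ : Fin (1 + n + 3 ^ n) => bern (1 / 2)).prod (bern (1 / 2)) with hν
  let E : Set ((Fin (1 + n + 3 ^ n) → Bool) × Bool) := {σ | ∀ j, σ.1 (selIdx n j) = true}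
  let A : Set ((Fin (1 + n + 3 ^ n) → Bool) × Bool) := {σ | σ.2 = !σ.1 (parIdx n k)}
  have hE : (ν E).toReal = (1 / 2) ^ n := by
    have : E = {x | ∀ j, x (selIdx n j) = true} ×ˢ Set.univ := by
      ext σ
      simp [E]
    rw [this, hν, Measure.prod_prod, measure_univ, mul_one, pi_forall_selIdx]
  have hEA : (ν (E ∩ A)).toReal = (ν E).toReal / 2 := by
    refine toReal_inter_of_preimage_eq_compl
      ((MeasurePreserving.id _).prod measurePreserving_not)
      MeasurableSet.of_discrete MeasurableSet.of_discrete ?_ rfl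
    ext ⟨x, b⟩
    cases b <;> simp [A]
  rw [← hE, ← hEA]
  refine ENNReal.toReal_mono (measure_ne_top _ _) (measure_mono ?_)
  rintro ⟨x, b⟩ ⟨hx, hb⟩
  have h := g_of_flip (y := Function.update x (parIdx n k) b) k hx
    ((Function.update_self ..).trans hb) (fun i hi => by simp [hi])
  simp [h]

theorem total_influence_ge (n : ℕ) :
    (1 / 2) * (3 / 2 : ℝ) ^ n ≤
      ∑ i : Fin (1 + n + 3 ^ n), influence (1 + n + 3 ^ n) (1 / 2) (g n) i := by
  calc (1 / 2) * (3 / 2 : ℝ) ^ n = ∑ _k : Fin (3 ^ n), (1 / 2 : ℝ) ^ n / 2 := by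
        simp only [Finset.sum_const, Finset.card_univ, Fintype.card_fin, nsmul_eq_mul,
          Nat.cast_pow, Nat.cast_ofNat, div_pow, one_pow]
        ring
    _ ≤ ∑ k, influence (1 + n + 3 ^ n) (1 / 2) (g n) (parIdx n k) :=
        Finset.sum_le_sum fun k _ => influence_parIdx_ge n k
    _ = ∑ i ∈ Finset.univ.map ⟨parIdx n, parIdx_injective n⟩,
          influence (1 + n + 3 ^ n) (1 / 2) (g n) i := by
        rw [Finset.sum_map]
        rfl
    _ ≤ _ := Finset.sum_le_sum_of_subset_of_nonneg (Finset.subset_univ _)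
        fun _ _ _ => ENNReal.toReal_nonneg

theorem tendsto_total_influence :
    Filter.Tendsto (fun n => ∑ i : Fin (1 + n + 3 ^ n), influence (1 + n + 3 ^ n) (1 / 2) (g n) i)
      Filter.atTop Filter.atTop :=
  Filter.tendsto_atTop_mono total_influence_ge
    ((tendsto_pow_atTop_atTop_of_one_lt (by norm_num)).const_mul_atTop (by norm_num))

section Noise

variable {ε : ℝ}

lemma isProbabilityMeasure_noise (h0 : 0 ≤ ε) (h1 : ε ≤ 1) (m : ℕ) :
    IsProbabilityMeasure (noiseμ m (1 / 2) ε) := by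
  have := isProbabilityMeasure_bern h0 h1
  unfold noiseμ
  infer_instance

lemma noise_resample (h0 : 0 ≤ ε) (h1 : ε ≤ 1) {m : ℕ} (i : Fin m) :
    (noiseμ m (1 / 2) ε).real {σ | (σ i).2.2 = true} = ε := by
  have := isProbabilityMeasure_bern h0 h1
  have h := pi_forall_mem (μ := (bern (1 / 2)).prod ((bern (1 / 2)).prod (bern ε)))
    (Function.injective_of_subsingleton fun _ : Unit => i)
    (Set.univ ×ˢ (Set.univ ×ˢ {true}))
  simp only [Measure.prod_prod, measure_univ, one_mul, bern_singleton_true, Set.mem_prod,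
    Set.mem_univ, true_and, Set.mem_singleton_iff, forall_const, Fintype.card_unit, pow_one] at h
  rw [Measure.real, noiseμ, h, ENNReal.toReal_ofReal h0]

lemma noise_forall_obs (h0 : 0 ≤ ε) (h1 : ε ≤ 1) (n : ℕ) :
    (noiseμ (1 + n + 3 ^ n) (1 / 2) ε).real {σ | ∀ j, obs σ (selIdx n j) = true}
      = (1 / 2) ^ n := by
  have := isProbabilityMeasure_bern h0 h1
  have h := pi_forall_mem (μ := (bern (1 / 2)).prod ((bern (1 / 2)).prod (bern ε)))
    (selIdx_injective n) ({true} ×ˢ Set.univ)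
  simp only [Measure.prod_prod, measure_univ, mul_one, bern_singleton_true, Set.mem_prod,
    Set.mem_univ, and_true, Set.mem_singleton_iff, Fintype.card_fin] at h
  simp only [obs]
  rw [Measure.real, noiseμ, h, ENNReal.toReal_pow, ENNReal.toReal_ofReal (by norm_num)]

lemma noise_forall_pert (h0 : 0 ≤ ε) (h1 : ε ≤ 1) (n : ℕ) :
    (noiseμ (1 + n + 3 ^ n) (1 / 2) ε).real {σ | ∀ j, pert σ (selIdx n j) = true}
      = (1 / 2) ^ n := by
  have := isProbabilityMeasure_bern h0 h1
  have h := pi_forall_mem (μ := (bern (1 / 2)).prod ((bern (1 / 2)).prod (bern ε)))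
    (selIdx_injective n) {t | (if t.2.2 then t.2.1 else t.1) = true}
  simp only [Set.mem_ofPred_eq, Fintype.card_fin] at h
  simp only [pert]
  rw [Measure.real, noiseμ, h, ENNReal.toReal_pow, pert_coord_true h0 h1]

/-- Any function of `m` bits is sensitive to the noise with probability at most `m * ε`. -/
lemma noise_ne_le_card_mul (h0 : 0 ≤ ε) (h1 : ε ≤ 1) {m : ℕ} (f : (Fin m → Bool) → Bool) :
    (noiseμ m (1 / 2) ε).real {σ | f (obs σ) ≠ f (pert σ)} ≤ m * ε := by
  have := isProbabilityMeasure_noise h0 h1 m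
  calc (noiseμ m (1 / 2) ε).real {σ | f (obs σ) ≠ f (pert σ)}
      ≤ (noiseμ m (1 / 2) ε).real (⋃ i, {σ | (σ i).2.2 = true}) := by
        refine measureReal_mono fun σ hσ => ?_
        by_contra hc
        simp only [Set.mem_iUnion, Set.mem_ofPred_eq, not_exists] at hc
        exact hσ (congrArg f (funext fun i => by simp [obs, pert, hc i]))
    _ ≤ ∑ i, (noiseμ m (1 / 2) ε).real {σ | (σ i).2.2 = true} := measureReal_iUnion_fintype_le _
    _ = m * ε := by simp only [noise_resample h0 h1, Finset.sum_const, Finset.card_univ,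
        Fintype.card_fin, nsmul_eq_mul]

lemma noise_g_ne_le (h0 : 0 ≤ ε) (h1 : ε ≤ 1) (n : ℕ) :
    (noiseμ (1 + n + 3 ^ n) (1 / 2) ε).real {σ | g n (obs σ) ≠ g n (pert σ)}
      ≤ 2 * (1 / 2) ^ n + ε := by
  have := isProbabilityMeasure_noise h0 h1 (1 + n + 3 ^ n)
  set ν := noiseμ (1 + n + 3 ^ n) (1 / 2) ε with hν
  calc ν.real {σ | g n (obs σ) ≠ g n (pert σ)}
      ≤ ν.real (({σ | ∀ j, obs σ (selIdx n j) = true} ∪ {σ | ∀ j, pert σ (selIdx n j) = true})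
          ∪ {σ | (σ (firstIdx n)).2.2 = true}) := by
        refine measureReal_mono fun σ hσ => ?_
        by_contra hc
        simp only [Set.mem_union, Set.mem_ofPred_eq, not_or] at hc
        obtain ⟨⟨h2, h3⟩, h4⟩ := hc
        refine hσ ?_
        rw [g_eq, g_eq, if_neg h2, if_neg h3]
        simp [obs, pert, h4]
    _ ≤ (1 / 2) ^ n + (1 / 2) ^ n + ε := by
        rw [← noise_resample h0 h1 (firstIdx n), ← hν]
        refine (measureReal_union_le _ _).trans (add_le_add_left ?_ _)
        refine (measureReal_union_le _ _).trans ?_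
        rw [hν, noise_forall_obs h0 h1, noise_forall_pert h0 h1]
    _ = _ := by ring

theorem g_noise_stable {δ : ℝ} (hδ : 0 < δ) : ∃ ε : ℝ, 0 < ε ∧ ∀ n : ℕ,
    (noiseμ (1 + n + 3 ^ n) (1 / 2) ε).real {σ | g n (obs σ) ≠ g n (pert σ)} ≤ δ := by
  obtain ⟨N, hN⟩ := exists_pow_lt_of_lt_one (show 0 < δ / 4 by positivity)
    (show (1 / 2 : ℝ) < 1 by norm_num)
  have hM : (0 : ℝ) < ((1 + N + 3 ^ N : ℕ) : ℝ) := by positivity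
  set M : ℝ := ((1 + N + 3 ^ N : ℕ) : ℝ) with hMdef
  have hpos : 0 < min (min 1 (δ / 2)) (δ / M) := by positivity
  refine ⟨min (min 1 (δ / 2)) (δ / M), hpos, fun n => ?_⟩
  set ε := min (min 1 (δ / 2)) (δ / M)
  have hε1 : ε ≤ 1 := (min_le_left _ _).trans (min_le_left _ _)
  have hε2 : ε ≤ δ / 2 := (min_le_left _ _).trans (min_le_right _ _)
  have hε3 : ε ≤ δ / M := min_le_right _ _
  rcases le_total n N with hn | hn
  · refine (noise_ne_le_card_mul hpos.le hε1 (g n)).trans ?_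
    have hle : ((1 + n + 3 ^ n : ℕ) : ℝ) ≤ M := by
      have := Nat.pow_le_pow_right (show 0 < 3 by norm_num) hn
      exact Nat.cast_le.2 (by omega)
    calc ((1 + n + 3 ^ n : ℕ) : ℝ) * ε ≤ M * (δ / M) := by gcongr
      _ = δ := by field_simp
  · have h := noise_g_ne_le hpos.le hε1 n
    have : (1 / 2 : ℝ) ^ n ≤ (1 / 2) ^ N :=
      pow_le_pow_of_le_one (by norm_num) (by norm_num) hn
    linarith

end Noise

end NoiseStableExample

/-- at p = 1/2, for every n ≥ 1: (a) P(f_n(ω) = 1) = 1/2; (b) the total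
influence is at least (1/2)(3/2)^n, and it tends to infinity; (c) the sequence {f_n} is
noise stable with respect to p ≡ 1/2. -/
theorem stmt_6 :
    (∀ n : ℕ, 1 ≤ n →
      ((Measure.pi fun _ : Fin (1 + n + 3^n) => bern (1/2))
        {x | g n x = true}).toReal = 1/2) ∧
    (∀ n : ℕ, 1 ≤ n →
      (1/2) * (3/2 : ℝ)^n ≤ ∑ i : Fin (1 + n + 3^n), influence (1 + n + 3^n) (1/2) (g n) i) ∧
    Filter.Tendsto (fun n => ∑ i : Fin (1 + n + 3^n), influence (1 + n + 3^n) (1/2) (g n) i)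
      Filter.atTop Filter.atTop ∧
    (∀ δ : ℝ, 0 < δ → ∃ ε : ℝ, 0 < ε ∧ ∀ n : ℕ, 1 ≤ n →
      ((noiseμ (1 + n + 3^n) (1/2) ε) {σ | g n (obs σ) ≠ g n (pert σ)}).toReal ≤ δ) := by
  refine ⟨fun n _ => NoiseStableExample.g_balanced n,
    fun n _ => NoiseStableExample.total_influence_ge n,
    NoiseStableExample.tendsto_total_influence, fun δ hδ => ?_⟩
  obtain ⟨ε, hε, h⟩ := NoiseStableExample.g_noise_stable hδ
  exact ⟨ε, hε, fun n _ => h n⟩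
end

section
/- Let ε ∈ (0, 1/4) and define the sequence (π_k) by π_0 = 2ε and π_{k+1} = (3/2)π_k − (1/2)π_k³. Then: (a) (π_k) is strictly increasing as long as π_k ∈ (0,1); (b) π_k < 2ε(3/2)^k for all k ≥ 1; (c) for every k such that π_k < 1/2, one has π_k > (3/4)·2ε(3/2)^k; and (d) π_k > 1/2 for every k ≥ log(1/(4ε))/log(3/2) + 1. -/
/-- One step of the bias recursion expands `p * (1 + p ^ 2)` by a factor of at least `3 / 2`
on `[0, 1 / 2]`. -/
lemma majority_potential_expands {p : ℝ} (hp0 : 0 ≤ p) (hp1 : p ≤ 1/2) :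
    (3/2) * (p * (1 + p^2)) ≤
      ((3/2) * p - (1/2) * p^3) * (1 + ((3/2) * p - (1/2) * p^3)^2) := by
  have hs : p^2 ≤ 1/4 := by nlinarith
  have hcube : (11/12 : ℝ)^3 ≤ (1 - p^2/3)^3 := by
    gcongr
    linarith
  have hfactor : 0 ≤ p^3 * ((27/8) * (1 - p^2/3)^3 - 2) :=
    mul_nonneg (by positivity) (by norm_num at hcube; linarith)
  linear_combination hfactor

/-- Let ε ∈ (0, 1/4) and define the sequence (π_k) by π_0 = 2ε and
π_{k+1} = (3/2)π_k − (1/2)π_k³. Then: (a) (π_k) is strictly increasing as long as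
π_k ∈ (0,1); (b) π_k < 2ε(3/2)^k for all k ≥ 1; (c) for every k such that
π_k < 1/2, one has π_k > (3/4)·2ε(3/2)^k; and (d) π_k > 1/2 for every
k ≥ log(1/(4ε))/log(3/2) + 1. -/
theorem stmt_8 (ε : ℝ) (hε0 : 0 < ε) (hε1 : ε < 1/4)
    (π : ℕ → ℝ) (hπ0 : π 0 = 2 * ε)
    (hπrec : ∀ k, π (k+1) = (3/2) * π k - (1/2) * (π k)^3) :
    (∀ k, 0 < π k → π k < 1 → π k < π (k+1)) ∧
    (∀ k, 1 ≤ k → π k < 2 * ε * (3/2)^k) ∧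
    (∀ k, π k < 1/2 → (3/4) * (2 * ε * (3/2)^k) < π k) ∧
    (∀ k : ℕ, Real.log (1/(4*ε)) / Real.log (3/2) + 1 ≤ (k : ℝ) → 1/2 < π k) := by
  have hmem : ∀ k, 0 < π k ∧ π k < 1 := by
    intro k
    induction k with
    | zero => constructor <;> linarith
    | succ k ih =>
      obtain ⟨h0, h1⟩ := ih
      rw [hπrec]
      constructor
      · nlinarith [mul_pos h0 (sub_pos.2 h1), mul_pos (mul_pos h0 h0) (sub_pos.2 h1)]
      · have : 0 < (1 - π k)^2 * (π k + 2) :=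
          mul_pos (pow_pos (sub_pos.2 h1) 2) (by linarith)
        linarith
  have hmono : ∀ k, 0 < π k → π k < 1 → π k < π (k+1) := by
    intro k h0 h1
    rw [hπrec]
    nlinarith [mul_pos h0 (sub_pos.2 h1), mul_pos (mul_pos h0 h0) (sub_pos.2 h1)]
  have hstep : ∀ k, π (k+1) < (3/2) * π k := by
    intro k
    have := pow_pos (hmem k).1 3
    rw [hπrec]
    linarith
  have hupper : ∀ k, π k ≤ 2 * ε * (3/2)^k := by
    intro k
    induction k with
    | zero => simp [hπ0]
    | succ k ih =>
      rw [pow_succ]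
      linarith [hstep k]
  have hpotential : ∀ k, π k ≤ 1/2 → 2 * ε * (3/2)^k ≤ π k * (1 + (π k)^2) := by
    intro k
    induction k with
    | zero =>
      intro _
      rw [hπ0]
      have := pow_pos hε0 3
      linarith
    | succ k ih =>
      intro hk
      have hk' : π k ≤ 1/2 := (hmono k (hmem k).1 (hmem k).2).le.trans hk
      have := majority_potential_expands (hmem k).1.le hk'
      rw [← hπrec k] at this
      rw [pow_succ]
      linarith [ih hk']
  have hlower : ∀ k, π k ≤ 1/2 → (3/4) * (2 * ε * (3/2)^k) < π k := by
    intro k hk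
    have h0 := (hmem k).1
    have hsq : (π k)^2 ≤ 1/4 := by nlinarith
    linarith [hpotential k hk, mul_le_mul_of_nonneg_left hsq h0.le]
  refine ⟨hmono, ?_, fun k hk => hlower k hk.le, ?_⟩
  · rintro (_ | k) hk
    · omega
    · rw [pow_succ]
      linarith [hstep k, hupper k]
  · intro k hk
    by_contra! hle
    have hlog : 0 < Real.log (3/2) := Real.log_pos (by norm_num)
    have hε4 : 0 < 1 / (4*ε) := by positivity
    have hpow : (3/2) * (1 / (4*ε)) ≤ (3/2 : ℝ)^k := by
      rw [← Real.log_le_log_iff (by positivity) (by positivity),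
        Real.log_mul (by norm_num) hε4.ne', Real.log_pow]
      have := (div_le_iff₀ hlog).1 (le_sub_iff_add_le.2 hk)
      linarith
    have hlarge : 3/4 ≤ 2 * ε * (3/2)^k := calc
      (3/4 : ℝ) = 2 * ε * ((3/2) * (1 / (4*ε))) := by field_simp
      _ ≤ 2 * ε * (3/2)^k := by gcongr
    linarith [hlower k hle]
end

section
/- Let a_0 ∈ (5/32, 1/4] and define a_{k+1} = 3a_k² − 2a_k³ for k ≥ 0. Then for every k ≥ 0: (2/5)(3/8)^{2^k} ≤ a_k ≤ (1/3)(3/4)^{2^k}. In particular, the explicit solution of the comparison recursion d_{k+1} = 3d_k², d_0 = 1/4 is d_k = (1/3)(3/4)^{2^k}. -/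
/-- Let a_0 ∈ (5/32, 1/4] and a_{k+1} = 3a_k² − 2a_k³. Then for every k,
(2/5)(3/8)^{2^k} ≤ a_k ≤ (1/3)(3/4)^{2^k}. In particular, the explicit solution of
d_{k+1} = 3d_k², d_0 = 1/4 is d_k = (1/3)(3/4)^{2^k}. -/
theorem stmt_9 (a d : ℕ → ℝ) (ha0 : 5/32 < a 0) (ha0' : a 0 ≤ 1/4)
    (harec : ∀ k, a (k+1) = 3 * (a k)^2 - 2 * (a k)^3)
    (hd0 : d 0 = 1/4) (hdrec : ∀ k, d (k+1) = 3 * (d k)^2) :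
    (∀ k : ℕ, (2/5) * (3/8 : ℝ)^(2^k) ≤ a k ∧ a k ≤ (1/3) * (3/4 : ℝ)^(2^k)) ∧
    (∀ k : ℕ, d k = (1/3) * (3/4 : ℝ)^(2^k)) := by
  have pow_step : ∀ (x : ℝ) (k : ℕ), x ^ 2 ^ (k + 1) = (x ^ 2 ^ k) ^ 2 := fun x k => by
    rw [pow_succ 2 k, pow_mul]
  refine ⟨fun k => ?_, fun k => ?_⟩
  · induction k with
    | zero => constructor <;> norm_num <;> linarith
    | succ k ih =>
      obtain ⟨hl, hu⟩ := ih
      have hx : (0 : ℝ) < (3 / 8) ^ 2 ^ k := by positivity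
      have hy : ((3 : ℝ) / 4) ^ 2 ^ k ≤ 3 / 4 :=
        pow_le_of_le_one (by norm_num) (by norm_num) (by positivity)
      have hpos : 0 ≤ a k := by linarith
      have hquarter : a k ≤ 1 / 4 := by linarith
      have hlsq := pow_le_pow_left₀ (by positivity) hl 2
      have husq := pow_le_pow_left₀ hpos hu 2
      have hcube : 0 ≤ a k ^ 3 := by positivity
      have hcube' : 0 ≤ a k ^ 2 * (1 / 4 - a k) := mul_nonneg (sq_nonneg _) (by linarith)
      rw [harec, pow_step, pow_step]
      constructor <;> linarith
  · induction k with
    | zero => norm_num [hd0]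
    | succ k ih =>
      rw [hdrec, ih, pow_step]
      ring
end

section
/- Let α ≥ 0 be fixed, set α_0 = log(3/2)/log 2 and ξ = log(4/3)/(2 log(3/2)). For each n, let γ_n = n^α, ε_n = γ_n(2/3)^n, p_n = 1/2 − ε_n, and define a_k^{(n)} by a_0^{(n)} = p_n and a_{k+1}^{(n)} = 3(a_k^{(n)})² − 2(a_k^{(n)})³. Then for all sufficiently large n, (1/3)(2/3)^{8ξ·(4γ_n)^{1/α_0}} ≤ a_n^{(n)} ≤ (1/3)(2/3)^{(ξ/2)·(4γ_n)^{1/α_0}}; equivalently, a_n^{(n)} = (1/3)(2/3)^{η_n (4γ_n)^{1/α_0}} for some η_n ∈ [ξ/2, 8ξ]. -/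
open Filter in
lemma eventually_four_mul_rpow_lt (α : ℝ) :
    ∀ᶠ n : ℕ in atTop, 4 * (n : ℝ) ^ α < (3 / 2 : ℝ) ^ n := by
  have h := (isLittleO_rpow_exp_pos_mul_atTop α
    (Real.log_pos (by norm_num : (1 : ℝ) < 3 / 2))).comp_tendsto tendsto_natCast_atTop_atTop
  filter_upwards [h.bound (show (0 : ℝ) < 1 / 8 by norm_num)] with n hn
  have hpos : (0 : ℝ) < (3 / 2 : ℝ) ^ n := by positivity
  have he : Real.exp (Real.log (3 / 2) * n) = (3 / 2 : ℝ) ^ n := by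
    rw [mul_comm, Real.exp_nat_mul, Real.exp_log (by norm_num)]
  simp only [Function.comp_apply, he, Real.norm_eq_abs, abs_of_pos hpos] at hn
  linarith [le_abs_self ((n : ℝ) ^ α)]

/-- While the bias `1/2 - b k` is small it grows like `X = x (3/2)^k`, up to a cubic error. -/
lemma majority_linear_phase {b : ℕ → ℝ} {x : ℝ} (hx0 : 0 ≤ x) (hx : x ≤ 1 / 2)
    (h0 : b 0 = 1 / 2 - x) (hrec : ∀ k, b (k + 1) = 3 * b k ^ 2 - 2 * b k ^ 3) (k : ℕ) :
    0 ≤ b k ∧ b k ≤ 1 / 2 ∧ 1 / 2 - x * (3 / 2) ^ k ≤ b k ∧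
      b k ≤ 1 / 2 - x * (3 / 2) ^ k + 16 / 15 * (x * (3 / 2) ^ k) ^ 3 := by
  induction k with
  | zero =>
    have : 0 ≤ x ^ 3 := by positivity
    refine ⟨?_, ?_, ?_, ?_⟩ <;> simp only [h0, pow_zero, mul_one] <;> linarith
  | succ k ih =>
    obtain ⟨hb0, hb1, hlo, hhi⟩ := ih
    have hX : 0 ≤ x * (3 / 2) ^ k := by positivity
    rw [hrec, pow_succ (3 / 2 : ℝ), ← mul_assoc]
    generalize x * (3 / 2) ^ k = X at *
    obtain ⟨d, hd⟩ : ∃ d, b k = 1 / 2 - d := ⟨1 / 2 - b k, by ring⟩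
    rw [hd] at hb0 hb1 hlo hhi ⊢
    have hd0 : 0 ≤ d := by linarith
    have hd1 : d ≤ 1 / 2 := by linarith
    have hd3 : 0 ≤ d ^ 3 := by positivity
    have hX3 : 0 ≤ X ^ 3 := by positivity
    have hstep : 3 * (1 / 2 - d) ^ 2 - 2 * (1 / 2 - d) ^ 3 = 1 / 2 - 3 / 2 * d + 2 * d ^ 3 := by
      ring
    have hdd : 0 ≤ d * (1 / 4 - d ^ 2) := mul_nonneg hd0 (by nlinarith)
    rw [hstep]
    refine ⟨?_, ?_, by linarith, ?_⟩
    · nlinarith [mul_nonneg (sq_nonneg (1 / 2 - d)) (by linarith : 0 ≤ 1 + d)]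
    · nlinarith
    · rcases le_total (X - 16 / 15 * X ^ 3) 0 with hH | hH
      · nlinarith
      · set H := X - 16 / 15 * X ^ 3 with hHdef
        have hHd : H ≤ d := by linarith
        have hmono : 3 / 2 * H - 2 * H ^ 3 ≤ 3 / 2 * d - 2 * d ^ 3 := by
          have : 0 ≤ (d - H) * (3 / 2 - 2 * (d ^ 2 + d * H + H ^ 2)) :=
            mul_nonneg (by linarith) (by nlinarith)
          linarith [this, show (d - H) * (3 / 2 - 2 * (d ^ 2 + d * H + H ^ 2)) =
            3 / 2 * d - 2 * d ^ 3 - (3 / 2 * H - 2 * H ^ 3) by ring]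
        have hH3 : H ^ 3 ≤ X ^ 3 := pow_le_pow_left₀ hH (by linarith) 3
        have : (X * (3 / 2)) ^ 3 = 27 / 8 * X ^ 3 := by ring
        linarith

lemma majority_quadratic_phase {b : ℕ → ℝ} (hb0 : ∀ k, 0 ≤ b k) (hb1 : ∀ k, b k ≤ 1 / 2)
    (hrec : ∀ k, b (k + 1) = 3 * b k ^ 2 - 2 * b k ^ 3) (k m : ℕ) :
    (2 * b k) ^ 2 ^ m ≤ 2 * b (k + m) ∧ 3 * b (k + m) ≤ (3 * b k) ^ 2 ^ m := by
  induction m with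
  | zero => simp
  | succ m ih =>
    have h0 := hb0 (k + m)
    have h1 := hb1 (k + m)
    have hk := hb0 k
    rw [← add_assoc, hrec, pow_succ, pow_mul, pow_mul]
    constructor
    · refine (pow_le_pow_left₀ (by positivity) ih.1 2).trans ?_
      nlinarith [mul_nonneg (sq_nonneg (b (k + m))) (sub_nonneg.2 h1)]
    · refine le_trans ?_ (pow_le_pow_left₀ (by positivity) ih.2 2)
      nlinarith [pow_nonneg h0 3]

lemma two_thirds_rpow_mul (y : ℝ) :
    (2 / 3 : ℝ) ^ (Real.log (4 / 3) / (2 * Real.log (3 / 2)) * y) = (3 / 4 : ℝ) ^ (y / 2) := by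
  have hl : Real.log (3 / 2) ≠ 0 := (Real.log_pos (by norm_num)).ne'
  have h1 : Real.log (2 / 3) = -Real.log (3 / 2) := by rw [← Real.log_inv]; norm_num
  have h2 : Real.log (3 / 4) = -Real.log (4 / 3) := by rw [← Real.log_inv]; norm_num
  rw [Real.rpow_def_of_pos (by norm_num), Real.rpow_def_of_pos (by norm_num), h1, h2]
  congr 1
  field_simp

lemma three_halves_rpow_inv :
    (3 / 2 : ℝ) ^ (1 / (Real.log (3 / 2) / Real.log 2)) = 2 := by
  have hl : Real.log (3 / 2) ≠ 0 := (Real.log_pos (by norm_num)).ne'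
  rw [Real.rpow_def_of_pos (by norm_num), one_div_div, mul_div_cancel₀ _ hl,
    Real.exp_log (by norm_num)]

lemma three_fourths_rpow_le {u : ℝ} (hu1 : 1 ≤ u) (hu2 : u ≤ 3 / 2) :
    (3 / 4 : ℝ) ^ (4 * u) ≤ 1 - u / 2 := by
  rcases le_total u (5 / 4) with h | h
  · calc (3 / 4 : ℝ) ^ (4 * u) ≤ (3 / 4 : ℝ) ^ ((4 : ℕ) : ℝ) :=
          Real.rpow_le_rpow_of_exponent_ge (by norm_num) (by norm_num) (by push_cast; linarith)
      _ ≤ 1 - u / 2 := by rw [Real.rpow_natCast]; norm_num; linarith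
  · calc (3 / 4 : ℝ) ^ (4 * u) ≤ (3 / 4 : ℝ) ^ ((5 : ℕ) : ℝ) :=
          Real.rpow_le_rpow_of_exponent_ge (by norm_num) (by norm_num) (by push_cast; linarith)
      _ ≤ 1 - u / 2 := by rw [Real.rpow_natCast]; norm_num; linarith


/-- With α ≥ 0, α₀ = log(3/2)/log 2, ξ = log(4/3)/(2 log(3/2)),
γ_n = n^α, ε_n = γ_n(2/3)^n, p_n = 1/2 − ε_n, and a^{(n)} the iterated 3-majority
recursion started at p_n, for all sufficiently large n one has
(1/3)(2/3)^{8ξ(4γ_n)^{1/α₀}} ≤ a_n^{(n)} ≤ (1/3)(2/3)^{(ξ/2)(4γ_n)^{1/α₀}}. -/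
theorem stmt_10 (α : ℝ) (hα : 0 ≤ α)
    (α₀ ξ : ℝ) (hα₀ : α₀ = Real.log (3/2) / Real.log 2)
    (hξ : ξ = Real.log (4/3) / (2 * Real.log (3/2)))
    (γ ε p : ℕ → ℝ)
    (hγ : ∀ n, γ n = (n : ℝ) ^ α)
    (hε : ∀ n, ε n = γ n * (2/3 : ℝ)^n)
    (hp : ∀ n, p n = 1/2 - ε n)
    (a : ℕ → ℕ → ℝ)
    (ha0 : ∀ n, a n 0 = p n)
    (harec : ∀ n k, a n (k+1) = 3 * (a n k)^2 - 2 * (a n k)^3) :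
    ∃ N : ℕ, ∀ n, N ≤ n →
      (1/3) * (2/3 : ℝ) ^ (8 * ξ * (4 * γ n) ^ (1/α₀)) ≤ a n n ∧
      a n n ≤ (1/3) * (2/3 : ℝ) ^ ((ξ/2) * (4 * γ n) ^ (1/α₀)) := by
  subst hα₀ hξ
  have hlog : Real.log (3 / 2) ≤ Real.log 2 := Real.log_le_log (by norm_num) (by norm_num)
  have hlog0 : 0 < Real.log (3 / 2) := Real.log_pos (by norm_num)
  have hβ1 : 1 ≤ 1 / (Real.log (3 / 2) / Real.log 2) := by
    rw [one_div_div, one_le_div hlog0]; exact hlog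
  have hβ := three_halves_rpow_inv
  obtain ⟨N, hN⟩ := Filter.eventually_atTop.1
    ((eventually_four_mul_rpow_lt α).and (Filter.eventually_ge_atTop 1))
  refine ⟨N, fun n hn => ?_⟩
  obtain ⟨hlt, hn1⟩ := hN n hn
  have hγ1 : 1 ≤ γ n := by
    rw [hγ]; exact Real.one_le_rpow (by exact_mod_cast hn1) hα
  rw [← hγ] at hlt
  obtain ⟨m, hm1, hm2⟩ := exists_nat_pow_near (by linarith : 1 ≤ 4 * γ n)
    (by norm_num : (1 : ℝ) < 3 / 2)
  have hmn : m ≤ n := ((pow_lt_pow_iff_right₀ (by norm_num)).1 (hm1.trans_lt hlt)).le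
  obtain ⟨k, rfl⟩ := Nat.exists_eq_add_of_le' hmn
  set u := 4 * γ (k + m) * (2 / 3 : ℝ) ^ m with hu
  have hinv : (3 / 2 : ℝ) ^ m * (2 / 3) ^ m = 1 := by rw [← mul_pow]; norm_num
  have hinv' : (2 / 3 : ℝ) ^ k * (3 / 2) ^ k = 1 := by rw [← mul_pow]; norm_num
  have hγu : 4 * γ (k + m) = (3 / 2) ^ m * u := by
    rw [hu]; linear_combination (-4 * γ (k + m)) * hinv
  have hpos : (0 : ℝ) < (3 / 2) ^ m := by positivity
  have hu1 : 1 ≤ u := by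
    rw [hγu] at hm1; exact (le_mul_iff_one_le_right hpos).1 hm1
  have hu2 : u ≤ 3 / 2 := by
    rw [hγu, pow_succ] at hm2; exact (lt_of_mul_lt_mul_left hm2 hpos.le).le
  have hεu : ε (k + m) * (3 / 2) ^ k = u / 4 := by
    rw [hε, hu, pow_add]; linear_combination γ (k + m) * (2 / 3) ^ m * hinv'
  have hε0 : 0 ≤ ε (k + m) := by rw [hε]; positivity
  have hε1 : ε (k + m) ≤ 1 / 2 := by
    have := le_mul_of_one_le_right hε0 (one_le_pow₀ (by norm_num : (1 : ℝ) ≤ 3 / 2) (n := k))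
    linarith
  have hlin := majority_linear_phase hε0 hε1 ((ha0 _).trans (hp _)) (harec (k + m))
  obtain ⟨hq1, hq2⟩ := majority_quadratic_phase (fun j => (hlin j).1) (fun j => (hlin j).2.1)
    (harec (k + m)) k m
  obtain ⟨hb0, -, hlo, hhi⟩ := hlin k
  rw [hεu] at hlo hhi
  set T := u ^ (1 / (Real.log (3 / 2) / Real.log 2)) with hT
  have hTu : u ≤ T := by
    simpa only [Real.rpow_one] using Real.rpow_le_rpow_of_exponent_le hu1 hβ1
  have hT2 : T ≤ 2 := by
    rw [← hβ]; exact Real.rpow_le_rpow (by linarith) hu2 (by linarith)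
  have hpowT : (4 * γ (k + m)) ^ (1 / (Real.log (3 / 2) / Real.log 2)) = T * (2 ^ m : ℕ) := by
    rw [hγu, Real.mul_rpow hpos.le (by linarith), ← Real.rpow_natCast (3 / 2 : ℝ) m,
      ← Real.rpow_mul (by norm_num), mul_comm (m : ℝ), Real.rpow_mul_natCast (by norm_num), hβ,
      ← hT, mul_comm]
    push_cast
    rfl
  rw [hpowT]
  have hL : 8 * (Real.log (4 / 3) / (2 * Real.log (3 / 2))) * (T * (2 ^ m : ℕ)) =
      Real.log (4 / 3) / (2 * Real.log (3 / 2)) * (8 * T * (2 ^ m : ℕ)) := by ring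
  have hU : Real.log (4 / 3) / (2 * Real.log (3 / 2)) / 2 * (T * (2 ^ m : ℕ)) =
      Real.log (4 / 3) / (2 * Real.log (3 / 2)) * (T / 2 * (2 ^ m : ℕ)) := by ring
  rw [hL, hU, two_thirds_rpow_mul, two_thirds_rpow_mul,
    show 8 * T * (2 ^ m : ℕ) / 2 = 4 * T * (2 ^ m : ℕ) by ring,
    show T / 2 * (2 ^ m : ℕ) / 2 = T / 4 * (2 ^ m : ℕ) by ring,
    Real.rpow_mul_natCast (by norm_num), Real.rpow_mul_natCast (by norm_num)]
  constructor
  · have h1 : (3 / 4 : ℝ) ^ (4 * T) ≤ 2 * a (k + m) k :=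
      calc (3 / 4 : ℝ) ^ (4 * T) ≤ (3 / 4 : ℝ) ^ (4 * u) :=
            Real.rpow_le_rpow_of_exponent_ge (by norm_num) (by norm_num) (by linarith)
        _ ≤ 1 - u / 2 := three_fourths_rpow_le hu1 hu2
        _ ≤ 2 * a (k + m) k := by linarith
    have h2 := pow_le_pow_left₀ (by positivity) h1 (2 ^ m)
    have h3 : 0 ≤ ((3 / 4 : ℝ) ^ (4 * T)) ^ 2 ^ m := by positivity
    linarith
  · have h1 : 3 * a (k + m) k ≤ (3 / 4 : ℝ) ^ (T / 4) :=
      calc 3 * a (k + m) k ≤ 4 / 5 := by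
            nlinarith [mul_nonneg (sub_nonneg.2 hu1) (sub_nonneg.2 hu2),
              mul_nonneg (mul_nonneg (sub_nonneg.2 hu1) (sub_nonneg.2 hu2)) (by linarith : 0 ≤ u)]
        _ ≤ (3 / 4 : ℝ) ^ (1 / 2 : ℝ) := by
            rw [← Real.sqrt_eq_rpow]; exact Real.le_sqrt_of_sq_le (by norm_num)
        _ ≤ (3 / 4 : ℝ) ^ (T / 4) :=
            Real.rpow_le_rpow_of_exponent_ge (by norm_num) (by norm_num) (by linarith)
    have h2 := pow_le_pow_left₀ (by positivity) h1 (2 ^ m)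
    linarith
end

section
/- Let α > α_0 := log(3/2)/log 2 be fixed. For each n, let ε_n = n^α (2/3)^n, p_n = 1/2 − ε_n, and define a_k^{(n)} by a_0^{(n)} = p_n and a_{k+1}^{(n)} = 3(a_k^{(n)})² − 2(a_k^{(n)})³. Then 3^n · a_n^{(n)} → 0 as n → ∞. -/
open Filter Topology

lemma majority_mem_Icc {b : ℝ} (hb : b ∈ Set.Icc (0 : ℝ) (1 / 2)) :
    3 * b ^ 2 - 2 * b ^ 3 ∈ Set.Icc (0 : ℝ) (1 / 2) := by
  obtain ⟨h0, h1⟩ := hb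
  constructor
  · nlinarith [mul_nonneg (sq_nonneg b) (by linarith : 0 ≤ 3 - 2 * b)]
  · nlinarith [mul_nonneg (sq_nonneg (b - 1 / 2)) (by linarith : 0 ≤ 3 / 2 - b),
      mul_nonneg h0 (by linarith : 0 ≤ 1 / 2 - b)]

/-- The bound `1 / δ ^ 2 ≤ 1 / x ^ 2 + 4` propagates when `δ = 1 / 2 - b` evolves by the
majority map and `x` is multiplied by `3 / 2`. -/
lemma majority_bias_step {b x : ℝ} (hb : b ∈ Set.Icc (0 : ℝ) (1 / 2))
    (h : x ^ 2 ≤ (1 / 2 - b) ^ 2 * (1 + 4 * x ^ 2)) :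
    (3 / 2 * x) ^ 2 ≤
      (1 / 2 - (3 * b ^ 2 - 2 * b ^ 3)) ^ 2 * (1 + 4 * (3 / 2 * x) ^ 2) := by
  obtain ⟨h0, h1⟩ := hb
  obtain ⟨e, he⟩ : ∃ e, e = 4 * (1 / 2 - b) ^ 2 := ⟨_, rfl⟩
  have he0 : 0 ≤ e := by rw [he]; positivity
  have he1 : e ≤ 1 := by rw [he]; nlinarith
  have hδ : (1 / 2 - (3 * b ^ 2 - 2 * b ^ 3)) ^ 2 = e * (3 - e) ^ 2 / 16 := by
    rw [he]; ring
  have hx : x ^ 2 * (1 - e) ≤ e / 4 := by rw [he]; linarith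
  have hmul : x ^ 2 * (1 - e) * ((1 - e) * (4 - e)) ≤ e / 4 * ((1 - e) * (4 - e)) :=
    mul_le_mul_of_nonneg_right hx (mul_nonneg (by linarith) (by linarith))
  have hpoly : 9 / 4 * ((1 - e) * (4 - e)) ≤ (3 - e) ^ 2 := by nlinarith
  have hmul' := mul_le_mul_of_nonneg_left hpoly he0
  rw [hδ]
  linarith

section Iterate

variable {u : ℕ → ℝ}

lemma majority_iterate_mem_Icc (hrec : ∀ k, u (k + 1) = 3 * u k ^ 2 - 2 * u k ^ 3)
    (h0 : u 0 ∈ Set.Icc (0 : ℝ) (1 / 2)) (k : ℕ) : u k ∈ Set.Icc (0 : ℝ) (1 / 2) := by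
  induction k with
  | zero => exact h0
  | succ k ih => rw [hrec]; exact majority_mem_Icc ih

lemma majority_iterate_bias (hrec : ∀ k, u (k + 1) = 3 * u k ^ 2 - 2 * u k ^ 3)
    (h0 : u 0 ∈ Set.Icc (0 : ℝ) (1 / 2)) (k : ℕ) :
    ((3 / 2) ^ k * (1 / 2 - u 0)) ^ 2 ≤
      (1 / 2 - u k) ^ 2 * (1 + 4 * ((3 / 2) ^ k * (1 / 2 - u 0)) ^ 2) := by
  induction k with
  | zero => simp only [pow_zero, one_mul]; nlinarith [sq_nonneg ((1 / 2 - u 0) ^ 2)]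
  | succ k ih =>
    rw [hrec, pow_succ' (3 / 2 : ℝ), mul_assoc]
    exact majority_bias_step (majority_iterate_mem_Icc hrec h0 k) ih

lemma majority_iterate_le_tenth (hrec : ∀ k, u (k + 1) = 3 * u k ^ 2 - 2 * u k ^ 3)
    (h0 : u 0 ∈ Set.Icc (0 : ℝ) (1 / 2)) {m : ℕ}
    (hm : 1 ≤ (3 / 2) ^ m * (1 / 2 - u 0)) : u m ≤ 1 / 10 := by
  have hbias := majority_iterate_bias hrec h0 m
  obtain ⟨-, hle⟩ := majority_iterate_mem_Icc hrec h0 m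
  by_contra! hlt
  have hsq : (1 / 2 - u m) ^ 2 ≤ 4 / 25 := by nlinarith
  have hx : 1 ≤ ((3 / 2) ^ m * (1 / 2 - u 0)) ^ 2 := one_le_pow₀ hm
  nlinarith

lemma three_mul_majority_iterate_le (hrec : ∀ k, u (k + 1) = 3 * u k ^ 2 - 2 * u k ^ 3)
    (h0 : u 0 ∈ Set.Icc (0 : ℝ) (1 / 2)) (m j : ℕ) :
    3 * u (m + j) ≤ (3 * u m) ^ 2 ^ j := by
  induction j with
  | zero => simp
  | succ j ih =>
    have hnn := (majority_iterate_mem_Icc hrec h0 (m + j)).1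
    calc 3 * u (m + (j + 1)) = 3 * (3 * u (m + j) ^ 2 - 2 * u (m + j) ^ 3) := by
          rw [← add_assoc, hrec]
      _ ≤ (3 * u (m + j)) ^ 2 := by nlinarith [pow_nonneg hnn 3]
      _ ≤ ((3 * u m) ^ 2 ^ j) ^ 2 := by gcongr
      _ = (3 * u m) ^ 2 ^ (j + 1) := by rw [← pow_mul, pow_succ]

end Iterate

lemma two_rpow_log_div_log : (2 : ℝ) ^ (Real.log (3 / 2) / Real.log 2) = 3 / 2 := by
  have := Real.log_pos (by norm_num : (1 : ℝ) < 2)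
  rw [Real.rpow_def_of_pos two_pos, mul_div_cancel₀ _ this.ne', Real.exp_log (by norm_num)]

lemma three_halves_pow_clog_le {n : ℕ} (hn : 1 ≤ n) :
    (3 / 2 : ℝ) ^ Nat.clog 2 n ≤ 3 / 2 * (n : ℝ) ^ (Real.log (3 / 2) / Real.log 2) := by
  have hpos : 0 < Real.log (3 / 2) / Real.log 2 :=
    div_pos (Real.log_pos (by norm_num)) (Real.log_pos (by norm_num))
  have hclog : 2 ^ Nat.clog 2 n ≤ 2 * n := by
    rcases hn.eq_or_lt with rfl | hn
    · simp
    · have hlt := Nat.pow_pred_clog_lt_self one_lt_two hn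
      have hc := Nat.clog_pos one_lt_two hn
      obtain ⟨c, hc'⟩ := Nat.exists_eq_succ_of_ne_zero hc.ne'
      rw [hc'] at hlt ⊢
      simp only [Nat.pred_succ, Nat.succ_eq_add_one, pow_succ] at hlt ⊢
      omega
  calc (3 / 2 : ℝ) ^ Nat.clog 2 n
      = ((2 : ℝ) ^ Nat.clog 2 n) ^ (Real.log (3 / 2) / Real.log 2) := by
        rw [← Real.rpow_pow_comm two_pos.le, two_rpow_log_div_log]
    _ ≤ (2 * n : ℝ) ^ (Real.log (3 / 2) / Real.log 2) := by
        gcongr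
        exact_mod_cast hclog
    _ = 3 / 2 * (n : ℝ) ^ (Real.log (3 / 2) / Real.log 2) := by
        rw [Real.mul_rpow two_pos.le n.cast_nonneg, two_rpow_log_div_log]

lemma tendsto_natCast_rpow_mul_pow (s : ℝ) {r : ℝ} (hr0 : 0 < r) (hr1 : r < 1) :
    Tendsto (fun n : ℕ => (n : ℝ) ^ s * r ^ n) atTop (𝓝 0) := by
  have h := (tendsto_rpow_mul_exp_neg_mul_atTop_nhds_zero s (-Real.log r)
    (by linarith [Real.log_neg hr0 hr1])).comp tendsto_natCast_atTop_atTop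
  refine h.congr fun n => ?_
  simp only [Function.comp_apply, neg_neg]
  rw [mul_comm (Real.log r), Real.exp_nat_mul, Real.exp_log hr0]

/-- Let α > α₀ := log(3/2)/log 2. With ε_n = n^α(2/3)^n,
p_n = 1/2 − ε_n and a^{(n)} the iterated 3-majority recursion started at p_n,
one has 3^n · a_n^{(n)} → 0 as n → ∞. -/
theorem stmt_11 (α : ℝ) (hα : Real.log (3/2) / Real.log 2 < α)
    (ε p : ℕ → ℝ)
    (hε : ∀ n, ε n = (n : ℝ) ^ α * (2/3 : ℝ)^n)
    (hp : ∀ n, p n = 1/2 - ε n)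
    (a : ℕ → ℕ → ℝ)
    (ha0 : ∀ n, a n 0 = p n)
    (harec : ∀ n k, a n (k+1) = 3 * (a n k)^2 - 2 * (a n k)^3) :
    Filter.Tendsto (fun n => (3 : ℝ)^n * a n n) Filter.atTop (nhds 0) := by
  have hsmall : ∀ᶠ n in atTop, ε n ≤ 1 / 2 := by
    have h := tendsto_natCast_rpow_mul_pow α (r := 2 / 3) (by norm_num) (by norm_num)
    filter_upwards [h.eventually_le_const (by norm_num : (0 : ℝ) < 1 / 2)] with n hn
    rw [hε]; exact hn
  have hgap : ∀ᶠ n : ℕ in atTop,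
      (3 / 2 : ℝ) ≤ (n : ℝ) ^ (α - Real.log (3 / 2) / Real.log 2) :=
    ((tendsto_rpow_atTop (sub_pos.2 hα)).comp
      tendsto_natCast_atTop_atTop).eventually_ge_atTop _
  have hbounds : ∀ᶠ n in atTop, 0 ≤ a n n ∧ a n n ≤ (3 / 10 : ℝ) ^ n := by
    filter_upwards [hsmall, hgap, eventually_ge_atTop 1] with n hn hng hn1
    have hε0 : 0 ≤ ε n := by rw [hε]; positivity
    have h0 : a n 0 ∈ Set.Icc (0 : ℝ) (1 / 2) := by
      rw [ha0, hp]; exact ⟨by linarith, by linarith⟩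
    have hmem := majority_iterate_mem_Icc (harec n) h0
    refine ⟨(hmem n).1, ?_⟩
    have hpow : (3 / 2 : ℝ) ^ Nat.clog 2 n ≤ (n : ℝ) ^ α := by
      have hnpos : (0 : ℝ) < n := by exact_mod_cast hn1
      calc (3 / 2 : ℝ) ^ Nat.clog 2 n
          ≤ 3 / 2 * (n : ℝ) ^ (Real.log (3 / 2) / Real.log 2) := three_halves_pow_clog_le hn1
        _ ≤ (n : ℝ) ^ (α - Real.log (3 / 2) / Real.log 2) *
            (n : ℝ) ^ (Real.log (3 / 2) / Real.log 2) := by gcongr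
        _ = (n : ℝ) ^ α := by rw [← Real.rpow_add hnpos, sub_add_cancel]
    obtain ⟨m, hm⟩ : ∃ m, n = m + Nat.clog 2 n :=
      Nat.exists_eq_add_of_le' (Nat.clog_le_of_le_pow Nat.lt_two_pow_self.le)
    have hgrow : 1 ≤ (3 / 2) ^ m * (1 / 2 - a n 0) := by
      have hcancel : (3 / 2 : ℝ) ^ n * (2 / 3) ^ n = 1 := by
        rw [← mul_pow]; norm_num
      calc (1 : ℝ) = (3 / 2) ^ m * (3 / 2) ^ Nat.clog 2 n * (2 / 3) ^ n := by
            rw [← pow_add, ← hm, hcancel]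
        _ ≤ (3 / 2) ^ m * (n : ℝ) ^ α * (2 / 3) ^ n := by gcongr
        _ = (3 / 2) ^ m * (1 / 2 - a n 0) := by rw [ha0, hp, hε]; ring
    have hm10 := majority_iterate_le_tenth (harec n) h0 hgrow
    have hm0 := (hmem m).1
    have hsquare := three_mul_majority_iterate_le (harec n) h0 m (Nat.clog 2 n)
    rw [← hm] at hsquare
    calc a n n ≤ 3 * a n n := by linarith [(hmem n).1]
      _ ≤ (3 * a n m) ^ 2 ^ Nat.clog 2 n := hsquare
      _ ≤ (3 / 10) ^ 2 ^ Nat.clog 2 n := by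
          gcongr
          linarith
      _ ≤ (3 / 10) ^ n :=
          pow_le_pow_of_le_one (by norm_num) (by norm_num) (Nat.le_pow_clog one_lt_two n)
  refine squeeze_zero' (g := fun n => (9 / 10 : ℝ) ^ n) ?_ ?_
    (tendsto_pow_atTop_nhds_zero_of_lt_one (by norm_num) (by norm_num))
  · filter_upwards [hbounds] with n hn
    exact mul_nonneg (by positivity) hn.1
  · filter_upwards [hbounds] with n hn
    calc (3 : ℝ) ^ n * a n n ≤ 3 ^ n * (3 / 10) ^ n := by gcongr; exact hn.2
      _ = (9 / 10) ^ n := by rw [← mul_pow]; norm_num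
end

section
/- Let a ∈ (0, 1/2], set a' = 3a² − 2a³, let b ∈ [0, a] and set b' = 3b² − 2b³ + 6b(a − b)². Write b = a(1 − β) with β ∈ [0,1] and b' = a'(1 − β'). Then β' = (2 − 2a³/a')β − (3a²/a')β² + (4a³/a')β³, and moreover β' ≥ (3/2)β − (3/2)β². -/
/-- Let a ∈ (0, 1/2], a' = 3a² − 2a³, b ∈ [0, a] and
b' = 3b² − 2b³ + 6b(a − b)².  Writing b = a(1 − β) with β ∈ [0,1] and
b' = a'(1 − β'), one has β' = (2 − 2a³/a')β − (3a²/a')β² + (4a³/a')β³ and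
β' ≥ (3/2)β − (3/2)β². -/
theorem stmt_12 (a a' b b' β β' : ℝ)
    (ha0 : 0 < a) (ha : a ≤ 1/2)
    (hA : a' = 3*a^2 - 2*a^3)
    (hb0 : 0 ≤ b) (hba : b ≤ a)
    (hB : b' = 3*b^2 - 2*b^3 + 6*b*(a - b)^2)
    (hβ : b = a * (1 - β)) (hβ0 : 0 ≤ β) (hβ1 : β ≤ 1)
    (hβ' : b' = a' * (1 - β')) :
    β' = (2 - 2*a^3/a') * β - (3*a^2/a') * β^2 + (4*a^3/a') * β^3 ∧
    (3/2) * β - (3/2) * β^2 ≤ β' := by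
  have hpos : 0 < a' := by
    have : 0 < a^2 * (3 - 2*a) := mul_pos (by positivity) (by linarith)
    linarith
  have key : a' * β' = (2*a' - 2*a^3) * β - 3*a^2 * β^2 + 4*a^3 * β^3 := by
    have h : a' * β' = a' - b' := by linarith
    rw [h, hB, hA, hβ]
    ring
  constructor
  · field_simp
    linarith
  · refine le_of_mul_le_mul_left ?_ hpos
    have h1 : 0 ≤ a^2 * (3/2 - 3*a) * (β + β^2) :=
      mul_nonneg (mul_nonneg (by positivity) (by linarith)) (by positivity)
    have h2 : 0 ≤ 4*a^3 * β^3 := by positivity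
    rw [key, hA]
    linarith
end

section
/- Let x_0 ∈ (0, 1/4) and define x_{k+1} = (3/2)x_k − (3/2)x_k² for k ≥ 0. Then the sequence (x_k) is strictly increasing, satisfies x_k < 1/3 for all k, and x_k ≥ 1/4 for every integer k ≥ log(1/x_0)/log(3/2) + 2. -/
/-- Let x₀ ∈ (0, 1/4) and x_{k+1} = (3/2)x_k − (3/2)x_k². Then (x_k) is
strictly increasing, x_k < 1/3 for all k, and x_k ≥ 1/4 for all integers
k ≥ log(1/x₀)/log(3/2) + 2. -/
theorem stmt_13 (x : ℕ → ℝ) (h0 : 0 < x 0) (h0' : x 0 < 1/4)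
    (hrec : ∀ k, x (k+1) = (3/2) * x k - (3/2) * (x k)^2) :
    StrictMono x ∧ (∀ k, x k < 1/3) ∧
    (∀ k : ℕ, Real.log (1/(x 0)) / Real.log (3/2) + 2 ≤ (k : ℝ) → 1/4 ≤ x k) := by
  have hbounds : ∀ k, 0 < x k ∧ x k < 1/3 := by
    intro k
    induction k with
    | zero => exact ⟨h0, by linarith⟩
    | succ k ih =>
      obtain ⟨hpos, hlt⟩ := ih
      rw [hrec]
      constructor <;> nlinarith
  have hdefect : ∀ k, (1 - 3 * x k) * ((3/2)^k * x 0) ≤ x k := by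
    intro k
    induction k with
    | zero => nlinarith
    | succ k ih =>
      obtain ⟨hpos, hlt⟩ := hbounds k
      have hmul := mul_le_mul_of_nonneg_left ih (show 0 ≤ 3/2 * (1 - 3/2 * x k) by linarith)
      have hfactor : (1 - 3 * x (k+1)) * ((3/2)^(k+1) * x 0) =
          3/2 * (1 - 3/2 * x k) * ((1 - 3 * x k) * ((3/2)^k * x 0)) := by
        rw [hrec]
        ring
      rw [hfactor, hrec]
      nlinarith
  refine ⟨strictMono_nat_of_lt_succ fun k => ?_, fun k => (hbounds k).2, fun k hk => ?_⟩
  · obtain ⟨hpos, hlt⟩ := hbounds k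
    rw [hrec]
    nlinarith
  · have hlog : 0 < Real.log (3/2) := Real.log_pos (by norm_num)
    have hgrowth : 9/4 ≤ (3/2 : ℝ)^k * x 0 := by
      rw [← Real.log_le_log_iff (by norm_num) (by positivity),
        Real.log_mul (by positivity) h0.ne', Real.log_pow,
        show (9/4 : ℝ) = (3/2)^2 by norm_num, Real.log_pow]
      have hdiv := (div_le_iff₀ hlog).mp (le_sub_iff_add_le.mpr hk)
      rw [one_div, Real.log_inv] at hdiv
      push_cast
      linarith
    nlinarith [hdefect k, hbounds k]
end

section
/- Let a > 0 with a ≤ 1/2, set a' = 3a² − 2a³, let ρ > 0, set b = a²(1 + ρ) and b' = 3b² − 2b³ + 6b(a − b)². Then b' = a'²(1 + ρ') where ρ' = (12a⁴(1−a)²/a'²)ρ + (3a⁴(1−2a)²/a'²)ρ² + (4a⁶/a'²)ρ³. Moreover, if in addition a ≥ 49/100 and ρ ≤ 9/16, then ρ' < (7/8)ρ. -/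
/-- Let 0 < a ≤ 1/2, a' = 3a² − 2a³, ρ > 0, b = a²(1 + ρ) and
b' = 3b² − 2b³ + 6b(a − b)².  Then b' = a'²(1 + ρ') where
ρ' = (12a⁴(1−a)²/a'²)ρ + (3a⁴(1−2a)²/a'²)ρ² + (4a⁶/a'²)ρ³; moreover if
a ≥ 49/100 and ρ ≤ 9/16 then ρ' < (7/8)ρ. -/
theorem stmt_14 (a a' ρ b b' : ℝ) (ha0 : 0 < a) (ha : a ≤ 1/2)
    (hA : a' = 3*a^2 - 2*a^3) (hρ : 0 < ρ)
    (hb : b = a^2 * (1 + ρ))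
    (hB : b' = 3*b^2 - 2*b^3 + 6*b*(a - b)^2) :
    b' = a'^2 * (1 + ((12*a^4*(1-a)^2/a'^2) * ρ + (3*a^4*(1-2*a)^2/a'^2) * ρ^2
        + (4*a^6/a'^2) * ρ^3)) ∧
    (49/100 ≤ a → ρ ≤ 9/16 →
      (12*a^4*(1-a)^2/a'^2) * ρ + (3*a^4*(1-2*a)^2/a'^2) * ρ^2
        + (4*a^6/a'^2) * ρ^3 < (7/8) * ρ) := by
  have hfac : a' = a^2 * (3 - 2*a) := by rw [hA]; ring
  have hpos : 0 < 3 - 2*a := by linarith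
  have ha' : a' ≠ 0 := by rw [hfac]; positivity
  refine ⟨?_, fun ha1 hρ1 => ?_⟩
  · field_simp
    rw [hB, hb, hA]
    ring
  · have hlin : (1 - 2*a)^2 * ρ ≤ (1/50)^2 * (9/16) := by
      gcongr <;> linarith
    have hcub : a^2 * ρ^2 ≤ (1/2)^2 * (9/16)^2 := by gcongr
    have key : 12*(1-a)^2 + 3*(1-2*a)^2*ρ + 4*a^2*ρ^2 < 7/8 * (3-2*a)^2 := by
      nlinarith [mul_nonneg (sub_nonneg.2 ha1) (sub_nonneg.2 ha)]
    have hρ' : (12*a^4*(1-a)^2/a'^2) * ρ + (3*a^4*(1-2*a)^2/a'^2) * ρ^2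
        + (4*a^6/a'^2) * ρ^3
        = (12*(1-a)^2 + 3*(1-2*a)^2*ρ + 4*a^2*ρ^2) / (3-2*a)^2 * ρ := by
      rw [hfac]
      field_simp
    rw [hρ']
    exact mul_lt_mul_of_pos_right ((div_lt_iff₀ (by positivity)).2 key) hρ
end

section
/- Let 0 < α < α_0 := log(3/2)/log 2 be fixed and let δ > 0. For each n, let ε_n = n^α(2/3)^n, define a_k^{(n)} by a_0^{(n)} = 1/2 − ε_n and a_{k+1}^{(n)} = 3(a_k^{(n)})² − 2(a_k^{(n)})³, and for t ∈ (0,1] define b_k^{(n)}(t) by b_0^{(n)}(t) = (1 + e^{−t})/4 − ε_n + ε_n²(1 − e^{−t}) and b_{k+1}^{(n)}(t) = 3(b_k^{(n)}(t))² − 2(b_k^{(n)}(t))³ + 6 b_k^{(n)}(t)(a_k^{(n)} − b_k^{(n)}(t))². Then for all sufficiently large n and all t with δ·a_n^{(n)} ≤ t ≤ 1, one has b_n^{(n)}(t) ≤ (1 + δ)(a_n^{(n)})². -/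
open Filter Topology

/-- Iterating the 3-majority map `x ↦ 3x² - 2x³` keeps `(0, 1/2]` invariant. -/
lemma majority_iterate_mem {x : ℕ → ℝ} (hrec : ∀ k, x (k + 1) = 3 * x k ^ 2 - 2 * x k ^ 3)
    (h0 : 0 < x 0) (h1 : x 0 ≤ 1 / 2) (k : ℕ) : 0 < x k ∧ x k ≤ 1 / 2 := by
  induction k with
  | zero => exact ⟨h0, h1⟩
  | succ k ih =>
    obtain ⟨hp, hle⟩ := ih
    rw [hrec]
    constructor
    · have : 0 < x k ^ 2 * (3 - 2 * x k) := mul_pos (by positivity) (by linarith)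
      linarith
    · nlinarith [mul_nonneg (sub_nonneg.2 hle) (mul_nonneg hp.le (sub_nonneg.2 hle)),
        mul_nonneg (sub_nonneg.2 hle) hp.le]

/-- The distance to the fixed point `1/2` grows by a factor at most `3/2` in each step. -/
lemma majority_iterate_gap_le {x : ℕ → ℝ}
    (hrec : ∀ k, x (k + 1) = 3 * x k ^ 2 - 2 * x k ^ 3)
    (h0 : 0 < x 0) (h1 : x 0 ≤ 1 / 2) (k : ℕ) :
    1 / 2 - x k ≤ (3 / 2 : ℝ) ^ k * (1 / 2 - x 0) := by
  induction k with
  | zero => simp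
  | succ k ih =>
    obtain ⟨-, hle⟩ := majority_iterate_mem hrec h0 h1 k
    have hcube : 0 ≤ (1 / 2 - x k) ^ 3 := pow_nonneg (by linarith) 3
    rw [hrec, pow_succ (3 / 2 : ℝ)]
    nlinarith

/-- The 3-majority map dominates squaring on `(0, 1/2]`. -/
lemma pow_two_pow_le_majority_iterate {x : ℕ → ℝ}
    (hrec : ∀ k, x (k + 1) = 3 * x k ^ 2 - 2 * x k ^ 3)
    (h0 : 0 < x 0) (h1 : x 0 ≤ 1 / 2) (k m : ℕ) : x k ^ 2 ^ m ≤ x (k + m) := by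
  induction m with
  | zero => simp
  | succ m ih =>
    obtain ⟨-, hle⟩ := majority_iterate_mem hrec h0 h1 (k + m)
    have hpos := (majority_iterate_mem hrec h0 h1 k).1
    calc x k ^ 2 ^ (m + 1) = (x k ^ 2 ^ m) ^ 2 := by rw [pow_succ, pow_mul]
      _ ≤ x (k + m) ^ 2 := by gcongr
      _ ≤ x (k + m + 1) := by
        rw [hrec]
        nlinarith [mul_nonneg (sq_nonneg (x (k + m))) (sub_nonneg.2 hle)]

/-- Decay of the covariance `y k - (x k)²` in the two-time 3-majority recursion: with
`u k = 4 (y k - (x k)²)` the ratio `u k / (1 - u k)` contracts by `3/4` in each step. -/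
lemma majority_covariance_decay {x y : ℕ → ℝ} {t : ℝ} (ht : 0 ≤ t)
    (hrec : ∀ k, x (k + 1) = 3 * x k ^ 2 - 2 * x k ^ 3)
    (hx0 : 0 < x 0) (hx1 : x 0 ≤ 1 / 2)
    (hyrec : ∀ k, y (k + 1) = 3 * y k ^ 2 - 2 * y k ^ 3 + 6 * y k * (x k - y k) ^ 2)
    (hy0 : 0 ≤ 4 * (y 0 - x 0 ^ 2)) (hy1 : 4 * (y 0 - x 0 ^ 2) ≤ 1)
    (hyt : t * (4 * (y 0 - x 0 ^ 2)) ≤ 1 - 4 * (y 0 - x 0 ^ 2)) (k : ℕ) :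
    0 ≤ 4 * (y k - x k ^ 2) ∧ 4 * (y k - x k ^ 2) ≤ 1 ∧
      t * (4 * (y k - x k ^ 2)) ≤ (3 / 4 : ℝ) ^ k * (1 - 4 * (y k - x k ^ 2)) := by
  induction k with
  | zero => exact ⟨hy0, hy1, by simpa using hyt⟩
  | succ k ih =>
    obtain ⟨hu0, hu1, hut⟩ := ih
    obtain ⟨hp, hle⟩ := majority_iterate_mem hrec hx0 hx1 k
    obtain ⟨V, hV⟩ : ∃ V, V = x k * (1 - x k) := ⟨_, rfl⟩
    have hV0 : 0 ≤ V := hV ▸ mul_nonneg hp.le (by linarith)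
    have hV1 : V ≤ 1 / 4 := by nlinarith [sq_nonneg (1 - 2 * x k)]
    have hstep : 4 * (y (k + 1) - x (k + 1) ^ 2)
        = 12 * V ^ 2 * (4 * (y k - x k ^ 2))
          + 3 / 4 * (1 - 4 * V) * (4 * (y k - x k ^ 2)) ^ 2
          + 1 / 4 * (4 * (y k - x k ^ 2)) ^ 3 := by
      rw [hyrec, hrec, hV]; ring
    set u := 4 * (y k - x k ^ 2)
    set u' := 4 * (y (k + 1) - x (k + 1) ^ 2)
    have hV4 : 0 ≤ 1 - 4 * V := by linarith
    have hu'0 : 0 ≤ u' := by rw [hstep]; positivity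
    have hu'1 : u' ≤ u * (3 + u ^ 2) / 4 := by
      have : 0 ≤ (1 - 4 * V) * u * (1 + 4 * V - u) :=
        mul_nonneg (mul_nonneg hV4 hu0) (by linarith)
      rw [hstep]; nlinarith
    have hfac : 1 - u * (3 + u ^ 2) / 4 = (1 - u) * (4 + u + u ^ 2) / 4 := by ring
    have hd : 0 ≤ 1 - u := by linarith
    have hlow : (1 - u) * (4 + u + u ^ 2) / 4 ≤ 1 - u' := by linarith
    have hL : (0 : ℝ) ≤ (3 / 4) ^ k := by positivity
    refine ⟨hu'0, ?_, ?_⟩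
    · have : 0 ≤ (1 - u) * (4 + u + u ^ 2) / 4 := by positivity
      linarith
    · calc t * u' ≤ t * (u * (3 + u ^ 2) / 4) := by gcongr
        _ = t * u * ((3 + u ^ 2) / 4) := by ring
        _ ≤ (3 / 4) ^ k * (1 - u) * ((3 + u ^ 2) / 4) := by gcongr
        _ ≤ (3 / 4) ^ k * (1 - u) * (3 / 4 * ((4 + u + u ^ 2) / 4)) := by
          gcongr
          nlinarith
        _ = (3 / 4) ^ (k + 1) * ((1 - u) * (4 + u + u ^ 2) / 4) := by ring
        _ ≤ (3 / 4) ^ (k + 1) * (1 - u') := by gcongr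

/-- For `α < log (3/2) / log 2` there are, for every large `n`, exponents `m` with
`(3/2)^m ≥ c n^α` although `2^m` is at most `n / C`. -/
lemma eventually_exists_pow_le_and_le_pow {α : ℝ} (hα : α < Real.log (3 / 2) / Real.log 2)
    {c : ℝ} (C : ℕ) (hC : 0 < C) :
    ∀ᶠ n : ℕ in atTop, ∃ m : ℕ, C * 2 ^ m ≤ n ∧ c * (n : ℝ) ^ α ≤ (3 / 2 : ℝ) ^ m := by
  set β := Real.log (3 / 2) / Real.log 2 with hβ
  have hβ0 : 0 < β := div_pos (Real.log_pos (by norm_num)) (Real.log_pos (by norm_num))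
  have h2β : (2 : ℝ) ^ β = 3 / 2 := by
    rw [Real.rpow_def_of_pos (by norm_num), hβ, mul_div_cancel₀ _
      (Real.log_pos (by norm_num : (1 : ℝ) < 2)).ne', Real.exp_log (by norm_num)]
  have hlim : Tendsto (fun n : ℕ => (n : ℝ) ^ (β - α)) atTop atTop :=
    (tendsto_rpow_atTop (sub_pos.2 hα)).comp tendsto_natCast_atTop_atTop
  filter_upwards [hlim.eventually_ge_atTop (c * (2 * C : ℝ) ^ β), eventually_ge_atTop C]
    with n hn hnC
  have hn0 : (0 : ℝ) < n := by exact_mod_cast hC.trans_le hnC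
  have hC0 : (0 : ℝ) < 2 * C := by positivity
  have hq : n / C ≠ 0 := (Nat.div_pos hnC hC).ne'
  refine ⟨Nat.log 2 (n / C), ?_, ?_⟩
  · calc C * 2 ^ Nat.log 2 (n / C) ≤ C * (n / C) := by
          gcongr; exact Nat.pow_log_le_self 2 hq
      _ ≤ n := Nat.mul_div_le n C
  · have hlt : n < C * 2 ^ (Nat.log 2 (n / C) + 1) := by
      have h := Nat.lt_pow_succ_log_self (b := 2) (by norm_num) (n / C)
      rw [Nat.div_lt_iff_lt_mul hC] at h
      rwa [mul_comm]
    set m := Nat.log 2 (n / C)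
    have hlt' : (n : ℝ) ≤ 2 ^ m * (2 * C) := by
      have : (n : ℝ) < C * 2 ^ (m + 1) := by exact_mod_cast hlt
      rw [pow_succ] at this
      linarith
    have hpow : ((2 : ℝ) ^ m) ^ β = (3 / 2) ^ m := by
      rw [← h2β, ← Real.rpow_natCast, ← Real.rpow_natCast, ← Real.rpow_mul (by norm_num),
        ← Real.rpow_mul (by norm_num), mul_comm]
    have hbase : (n : ℝ) ^ β ≤ (3 / 2) ^ m * (2 * C) ^ β := by
      rw [← hpow, ← Real.mul_rpow (by positivity) hC0.le]
      gcongr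
    have hsplit : (n : ℝ) ^ β = (n : ℝ) ^ (β - α) * (n : ℝ) ^ α := by
      rw [← Real.rpow_add hn0]; congr 1; ring
    have hpos : 0 < (2 * C : ℝ) ^ β := by positivity
    refine le_of_mul_le_mul_right ?_ hpos
    calc c * (n : ℝ) ^ α * (2 * C) ^ β = c * (2 * C) ^ β * (n : ℝ) ^ α := by ring
      _ ≤ (n : ℝ) ^ (β - α) * (n : ℝ) ^ α := by gcongr
      _ = (n : ℝ) ^ β := hsplit.symm
      _ ≤ _ := hbase


/-- Let 0 < α < α₀ := log(3/2)/log 2 and δ > 0. With ε_n = n^α(2/3)^n,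
a^{(n)} the iterated 3-majority recursion started at 1/2 − ε_n, and b^{(n)}(t) the
two-time recursion with b₀^{(n)}(t) = (1 + e^{−t})/4 − ε_n + ε_n²(1 − e^{−t}) and
b_{k+1} = 3b_k² − 2b_k³ + 6b_k(a_k − b_k)², for all sufficiently large n and all t
with δ·a_n^{(n)} ≤ t ≤ 1 one has b_n^{(n)}(t) ≤ (1 + δ)(a_n^{(n)})². -/
theorem stmt_15 (α : ℝ) (hα0 : 0 < α) (hα : α < Real.log (3/2) / Real.log 2)
    (δ : ℝ) (hδ : 0 < δ)
    (ε : ℕ → ℝ) (hε : ∀ n, ε n = (n : ℝ)^α * (2/3 : ℝ)^n)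
    (a : ℕ → ℕ → ℝ) (ha0 : ∀ n, a n 0 = 1/2 - ε n)
    (harec : ∀ n k, a n (k+1) = 3 * (a n k)^2 - 2 * (a n k)^3)
    (b : ℕ → ℕ → ℝ → ℝ)
    (hb0 : ∀ n t, b n 0 t = (1 + Real.exp (-t))/4 - ε n + (ε n)^2 * (1 - Real.exp (-t)))
    (hbrec : ∀ n k t, b n (k+1) t
      = 3 * (b n k t)^2 - 2 * (b n k t)^3 + 6 * (b n k t) * (a n k - b n k t)^2) :
    ∃ N : ℕ, ∀ n, N ≤ n → ∀ t : ℝ, δ * a n n ≤ t → t ≤ 1 →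
      b n n t ≤ (1 + δ) * (a n n)^2 := by
  have hpow : ∀ᶠ r : ℕ in atTop, (3 / 4 : ℝ) ^ r ≤ 4 * δ ^ 2 :=
    (tendsto_pow_atTop_nhds_zero_of_lt_one (by norm_num) (by norm_num)).eventually_le_const
      (by positivity)
  obtain ⟨R, hR⟩ := eventually_atTop.1 hpow
  obtain ⟨N, hN⟩ := eventually_atTop.1
    (eventually_exists_pow_le_and_le_pow hα (c := 4) 30 (by norm_num))
  refine ⟨max N (2 * R), fun n hn t hta ht1 => ?_⟩
  obtain ⟨m, hm, hmα⟩ := hN n (le_of_max_le_left hn)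
  have hnR : 2 * R ≤ n := le_of_max_le_right hn
  have hmn : m ≤ n := by
    have := Nat.lt_two_pow_self (n := m)
    omega
  have h23 (j : ℕ) : (3 / 2 : ℝ) ^ j * (2 / 3) ^ j = 1 := by
    rw [← mul_pow]; norm_num
  have hε0 : 0 ≤ ε n := by rw [hε]; positivity
  have hεm : (3 / 2 : ℝ) ^ (n - m) * ε n ≤ 1 / 4 := by
    have hsplit : (2 / 3 : ℝ) ^ n = (2 / 3) ^ (n - m) * (2 / 3) ^ m := by
      rw [← pow_add, Nat.sub_add_cancel hmn]
    calc (3 / 2 : ℝ) ^ (n - m) * ε n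
        = (3 / 2 : ℝ) ^ (n - m) * (2 / 3) ^ (n - m) * (n : ℝ) ^ α * (2 / 3) ^ m := by
          rw [hε, hsplit]; ring
      _ = (n : ℝ) ^ α * (2 / 3) ^ m := by rw [h23, one_mul]
      _ ≤ (3 / 2) ^ m / 4 * (2 / 3) ^ m := by gcongr; linarith
      _ = 1 / 4 := by linear_combination h23 m / 4
  have hε1 : ε n ≤ 1 / 4 := by
    have : (1 : ℝ) ≤ (3 / 2) ^ (n - m) := one_le_pow₀ (by norm_num)
    nlinarith
  have hx0 : 0 < a n 0 := by rw [ha0]; linarith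
  have hx1 : a n 0 ≤ 1 / 2 := by rw [ha0]; linarith
  have han := (majority_iterate_mem (harec n) hx0 hx1 n).1
  have ht : 0 < t := (mul_pos hδ han).trans_le hta
  have hlow : (3 / 4 : ℝ) ^ (5 * 2 ^ m) ≤ a n n := by
    have hgap := majority_iterate_gap_le (harec n) hx0 hx1 (n - m)
    have hg0 : 1 / 2 - a n 0 = ε n := by rw [ha0]; ring
    rw [hg0] at hgap
    calc (3 / 4 : ℝ) ^ (5 * 2 ^ m) = ((3 / 4) ^ 5) ^ 2 ^ m := pow_mul _ _ _
      _ ≤ a n (n - m) ^ 2 ^ m := by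
        gcongr
        norm_num
        linarith
      _ ≤ a n (n - m + m) := pow_two_pow_le_majority_iterate (harec n) hx0 hx1 _ _
      _ = a n n := by rw [Nat.sub_add_cancel hmn]
  have hsmall : (3 / 4 : ℝ) ^ n ≤ 4 * δ ^ 2 * a n n ^ 3 := by
    obtain ⟨r, hr⟩ : ∃ r, n = r + 5 * 2 ^ m * 3 := ⟨n - 5 * 2 ^ m * 3, by omega⟩
    calc (3 / 4 : ℝ) ^ n = (3 / 4) ^ r * ((3 / 4) ^ (5 * 2 ^ m)) ^ 3 := by
          rw [← pow_mul, ← pow_add, ← hr]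
      _ ≤ 4 * δ ^ 2 * a n n ^ 3 := by
        gcongr
        exact hR r (by omega)
  have hu : 4 * (b n 0 t - a n 0 ^ 2) = Real.exp (-t) * (1 - 4 * ε n ^ 2) := by
    rw [hb0, ha0]; ring
  have hε2 : 4 * ε n ^ 2 ≤ 1 := by nlinarith
  have hule : Real.exp (-t) * (1 - 4 * ε n ^ 2) ≤ Real.exp (-t) :=
    mul_le_of_le_one_right (Real.exp_pos _).le (by linarith [sq_nonneg (ε n)])
  have hexp : (1 + t) * Real.exp (-t) ≤ 1 := by
    calc (1 + t) * Real.exp (-t) ≤ Real.exp t * Real.exp (-t) := by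
          gcongr; linarith [Real.add_one_le_exp t]
      _ = 1 := by rw [← Real.exp_add]; simp
  obtain ⟨hu0, -, hut⟩ := majority_covariance_decay (x := a n) (y := fun k => b n k t) ht.le
    (harec n) hx0 hx1 (fun k => hbrec n k t)
    (by rw [hu]; exact mul_nonneg (Real.exp_pos _).le (by linarith))
    (by rw [hu]; exact hule.trans (Real.exp_le_one_iff.2 (by linarith)))
    (by rw [hu]; nlinarith) n
  set u := 4 * (b n n t - a n n ^ 2) with hu_def
  have h_bound : δ * a n n * u ≤ δ * a n n * (4 * δ * a n n ^ 2) := by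
    calc δ * a n n * u ≤ t * u := by gcongr
      _ ≤ (3 / 4) ^ n * (1 - u) := hut
      _ ≤ (3 / 4) ^ n := mul_le_of_le_one_right (by positivity) (by linarith)
      _ ≤ 4 * δ ^ 2 * a n n ^ 3 := hsmall
      _ = δ * a n n * (4 * δ * a n n ^ 2) := by ring
  have := le_of_mul_le_mul_left h_bound (mul_pos hδ han)
  linarith
end
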